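/- arXiv:1502.06952 — 3 statements merged into one kernel-verified Lean document; each statement's English description precedes it below -/
import Mathlib

section
/- Fix (α, β, θ) ∈ (0,1)³ with (1−θ)/2 < β < 1/2 and α < η̃^clu_θ(β). Let λ be the largest eigenvalue of XX' and ξ a corresponding unit eigenvector. Then there exist a constant δ = δ(α, β, θ) > 0 and a constant C > 0 such that for all sufficiently large p, with probability at least 1 − Cp^{−3}, min{‖√n·ξ + ℓ‖_∞, ‖√n·ξ − ℓ‖_∞} < p^{−δ}. Moreover, the same conclusion holds if Z is replaced by ZB_p for nonrandom invertible matrices B_p ∈ ℝ^{p×p} with p^{−δ'}·max{‖B_p‖, ‖B_p^{−1}‖} → 0 for every fixed δ' > 0 (spectral norms). -/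
open MeasureTheory ProbabilityTheory Filter
open scoped ENNReal NNReal Classical BigOperators

namespace ARWPaper

/-- `n = ⌈p^θ⌉`. -/
noncomputable def nDim (p : ℕ) (θ : ℝ) : ℕ := ⌈(p : ℝ) ^ θ⌉₊

/-- Law of a single class label: uniform on `{-1, 1}`. -/
noncomputable def signLaw : Measure ℝ :=
  (1 / 2 : ℝ≥0∞) • Measure.dirac (1 : ℝ) + (1 / 2 : ℝ≥0∞) • Measure.dirac (-1 : ℝ)

/-- Law of a single coordinate of `μ`: `τ` w.p. `ε`, `0` w.p. `1 - ε`. -/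
noncomputable def muLaw (ε τ : ℝ) : Measure ℝ :=
  ENNReal.ofReal (1 - ε) • Measure.dirac (0 : ℝ) + ENNReal.ofReal ε • Measure.dirac τ

/-- Standard Gaussian product measure on `ℝ^n`. -/
noncomputable def gaussPi (n : ℕ) : Measure (Fin n → ℝ) :=
  Measure.pi fun _ => gaussianReal 0 1

/-- Law of the noise matrix `Z` (i.i.d. `N(0,1)` entries, rows indexed by `Fin n`). -/
noncomputable def noiseLaw (n p : ℕ) : Measure (Fin n → Fin p → ℝ) :=
  Measure.pi fun _ => gaussPi p

/-- Sample space for `(ℓ, μ, Z)`. -/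
abbrev Omega (n p : ℕ) := (Fin n → ℝ) × (Fin p → ℝ) × (Fin n → Fin p → ℝ)

/-- Joint law of `(ℓ, μ, Z)`. -/
noncomputable def jointLaw (n p : ℕ) (ε τ : ℝ) : Measure (Omega n p) :=
  (Measure.pi fun _ : Fin n => signLaw).prod
    ((Measure.pi fun _ : Fin p => muLaw ε τ).prod (noiseLaw n p))

/-- Data matrix `X = ℓ μ' + Z`. -/
def dataMap {n p : ℕ} (ω : Omega n p) : Fin n → Fin p → ℝ :=
  fun i j => ω.1 i * ω.2.1 j + ω.2.2 i j

/-- Hamming clustering error of a clustering procedure `ell`, where the observed data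
matrix is `D ω`. -/
noncomputable def hammingClu (n p : ℕ) (ε τ : ℝ)
    (D : Omega n p → Fin n → Fin p → ℝ)
    (ell : (Fin n → Fin p → ℝ) → Fin n → ℝ) : ℝ :=
  (n : ℝ)⁻¹ * min
    (∑ i : Fin n, ((jointLaw n p ε τ) {ω | ell (D ω) i ≠ ω.1 i}).toReal)
    (∑ i : Fin n, ((jointLaw n p ε τ) {ω | ell (D ω) i ≠ -ω.1 i}).toReal)

/-- Hamming error for signal (support) recovery. -/
noncomputable def hammingSig (n p : ℕ) (ε τ : ℝ)
    (D : Omega n p → Fin n → Fin p → ℝ)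
    (S : (Fin n → Fin p → ℝ) → Finset (Fin p)) : ℝ :=
  ((p : ℝ) * ε)⁻¹ * ∑ j : Fin p,
    (((jointLaw n p ε τ) {ω | ω.2.1 j = 0 ∧ j ∈ S (D ω)}).toReal +
      ((jointLaw n p ε τ) {ω | ω.2.1 j ≠ 0 ∧ j ∉ S (D ω)}).toReal)

/-- Sum of type I and type II testing errors of the rejection region `R`. -/
noncomputable def testErr (n p : ℕ) (ε τ : ℝ)
    (R : Set (Fin n → Fin p → ℝ)) : ℝ :=
  ((noiseLaw n p) R).toReal + ((jointLaw n p ε τ) {ω | dataMap ω ∉ R}).toReal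

/-- Statistical boundary for clustering. -/
noncomputable def etaClu (θ β : ℝ) : ℝ :=
  if β < (1 - θ) / 2 then (1 - 2 * β) / 2
  else if β < 1 - θ then θ / 2
  else (1 - β) / 2

/-- CTUB boundary for clustering. -/
noncomputable def etaCluT (θ β : ℝ) : ℝ :=
  if β < (1 - θ) / 2 then (1 - 2 * β) / 2
  else if β < 1 / 2 then (1 + θ - 2 * β) / 4
  else if β < 1 - θ / 2 then θ / 4
  else (1 - β) / 2

/-- Statistical boundary for signal recovery. -/
noncomputable def etaSig (θ β : ℝ) : ℝ :=
  if β < 1 - θ then θ / 2 else (1 + θ - β) / 4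

/-- CTUB boundary for signal recovery. -/
noncomputable def etaSigT (θ β : ℝ) : ℝ :=
  if β < (1 - θ) / 2 then θ / 2
  else if β < 1 / 2 then (1 + θ - 2 * β) / 4
  else θ / 4

noncomputable def etaHyp1 (θ β : ℝ) : ℝ := (2 + θ - 4 * β) / 4
noncomputable def etaHyp2 (θ β : ℝ) : ℝ := min (θ / 2) ((1 + θ - β) / 4)
noncomputable def etaHyp (θ β : ℝ) : ℝ := max (etaHyp1 θ β) (etaHyp2 θ β)
noncomputable def etaHypT (θ β : ℝ) : ℝ := max (etaHyp1 θ β) (θ / 4)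

/-- Standard phase function `ρ*`. -/
noncomputable def rhoStar (b : ℝ) : ℝ :=
  if b < 3 / 4 then b - 1 / 2 else (1 - Real.sqrt (1 - b)) ^ 2

/-- Phase function for IF-PCA. -/
noncomputable def rhoStarTheta (θ β : ℝ) : ℝ :=
  (1 - θ) * rhoStar (1 / 2 + (β - 1 / 2) / (1 - θ))

/-- Euclidean norm of a vector. -/
noncomputable def l2 {n : ℕ} (v : Fin n → ℝ) : ℝ := Real.sqrt (∑ i, v i ^ 2)

/-- Entrywise sup-norm of a vector. -/
noncomputable def linf {n : ℕ} (v : Fin n → ℝ) : ℝ := ⨆ i, |v i|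

/-- `cos(x, y) = |⟨x/‖x‖, y/‖y‖⟩|`. -/
noncomputable def cosv {n : ℕ} (x y : Fin n → ℝ) : ℝ :=
  |∑ i, x i * y i| / (l2 x * l2 y)

/-- Spectral (operator) norm of a matrix. -/
noncomputable def specNorm {m k : ℕ} (A : Matrix (Fin m) (Fin k) ℝ) : ℝ :=
  sSup ((fun v => l2 (A.mulVec v)) '' {v | l2 v ≤ 1})

/-- Simple Aggregation clustering: entrywise sign of the sum of all columns. -/
noncomputable def ellSimpleAgg {n p : ℕ} (X : Fin n → Fin p → ℝ) : Fin n → ℝ :=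
  fun i => Real.sign (∑ j, X i j)

/-- `S` picks, for every data matrix, a size-`N` subset maximizing `‖∑_{j ∈ S} x_j‖₁`. -/
def IsSparseAggMaximizer {n p : ℕ} (N : ℕ)
    (S : (Fin n → Fin p → ℝ) → Finset (Fin p)) : Prop :=
  ∀ X, (S X).card = N ∧
    ∀ T : Finset (Fin p), T.card = N →
      ∑ i, |∑ j ∈ T, X i j| ≤ ∑ i, |∑ j ∈ S X, X i j|

/-- Sparse Aggregation clustering. -/
noncomputable def ellSparseAgg {n p : ℕ}
    (S : (Fin n → Fin p → ℝ) → Finset (Fin p)) (X : Fin n → Fin p → ℝ) :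
    Fin n → ℝ :=
  fun i => Real.sign (∑ j ∈ S X, X i j)

/-- Gram matrix `X X'`. -/
def gram {n p : ℕ} (X : Fin n → Fin p → ℝ) : Matrix (Fin n) (Fin n) ℝ :=
  Matrix.of fun i i' => ∑ j, X i j * X i' j

/-- `ξ` is a unit eigenvector of `A` associated with its largest eigenvalue. -/
def IsTopEigenvector {n : ℕ} (A : Matrix (Fin n) (Fin n) ℝ) (ξ : Fin n → ℝ) : Prop :=
  (∑ i, ξ i ^ 2) = 1 ∧
    ∃ lam : ℝ, A.mulVec ξ = lam • ξ ∧
      ∀ (lam' : ℝ) (v : Fin n → ℝ), v ≠ 0 → A.mulVec v = lam' • v → lam' ≤ lam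

/-- χ²-screening: the set of selected features. -/
noncomputable def chiSel {n p : ℕ} (q : ℝ) (X : Fin n → Fin p → ℝ) : Finset (Fin p) :=
  Finset.univ.filter fun j =>
    Real.sqrt (2 * q * Real.log p) ≤ ((∑ i, X i j ^ 2) - n) / Real.sqrt (2 * n)

/-- Post-selection Gram matrix `X^{(q)} (X^{(q)})'`. -/
noncomputable def gramSel {n p : ℕ} (q : ℝ) (X : Fin n → Fin p → ℝ) :
    Matrix (Fin n) (Fin n) ℝ :=
  Matrix.of fun i i' => ∑ j ∈ chiSel q X, X i j * X i' j

/-- IF-PCA calibration `τ_p* = p^{-θ/4} (4 r log p)^{1/4}`. -/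
noncomputable def tauStar (p : ℕ) (θ r : ℝ) : ℝ :=
  (p : ℝ) ^ (-(θ / 4)) * (4 * r * Real.log p) ^ ((1 : ℝ) / 4)

/-- The ideal threshold `q*` of IF-PCA in the Region of Possibility. -/
noncomputable def qStar (θ β r : ℝ) : ℝ :=
  if (β - θ / 2) / 3 < r then (β - θ / 2 + r) ^ 2 / (4 * r) else 4 * r

/-- Support of `μ`. -/
noncomputable def suppSet {p : ℕ} (μ : Fin p → ℝ) : Finset (Fin p) :=
  Finset.univ.filter fun j => μ j ≠ 0

/-- The event `D_p`: `| |S(μ)| - p ε_p | ≤ √(6 p ε_p log p)` with `ε_p = p^{-β}`. -/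
def inDp (β : ℝ) {p : ℕ} (μ : Fin p → ℝ) : Prop :=
  |((suppSet μ).card : ℝ) - (p : ℝ) * (p : ℝ) ^ (-β)| ≤
    Real.sqrt (6 * ((p : ℝ) * (p : ℝ) ^ (-β)) * Real.log p)

/-- Selection threshold `n + 2√(q n log p)` for the squared column norm. -/
noncomputable def thresh (p n : ℕ) (q : ℝ) : ℝ :=
  (n : ℝ) + 2 * Real.sqrt (q * n * Real.log p)

/-- `π₀ = P(‖z‖² > n + 2√(q n log p))`, `z ~ N(0, I_n)`. -/
noncomputable def pi0 (p n : ℕ) (q : ℝ) : ℝ :=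
  ((gaussPi n) {z | thresh p n q < ∑ i, z i ^ 2}).toReal

/-- `π₁ = P(‖z + τ ℓ‖² > n + 2√(q n log p))`, `z ~ N(0, I_n)`. -/
noncomputable def pi1 (p : ℕ) {n : ℕ} (q τ : ℝ) (ℓ : Fin n → ℝ) : ℝ :=
  ((gaussPi n) {z | thresh p n q < ∑ i, (z i + τ * ℓ i) ^ 2}).toReal

/-- Expected number of selected useless features (`s = |S(μ)|`). -/
noncomputable def m0q (p n : ℕ) (q : ℝ) (s : ℕ) : ℝ := ((p : ℝ) - s) * pi0 p n q

/-- Expected number of selected useful features. -/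
noncomputable def m1q (p : ℕ) {n : ℕ} (q τ : ℝ) (ℓ : Fin n → ℝ) (s : ℕ) : ℝ :=
  (s : ℝ) * pi1 p q τ ℓ

/-- `m^{(q)}`. -/
noncomputable def mq (p : ℕ) {n : ℕ} (q τ : ℝ) (ℓ : Fin n → ℝ) (s : ℕ) : ℝ :=
  m0q p n q s + m1q p q τ ℓ s

/-- `m_*^{(q)}`. -/
noncomputable def mstarq (p : ℕ) {n : ℕ} (q τ : ℝ) (ℓ : Fin n → ℝ) (s : ℕ) : ℝ :=
  ((p : ℝ) - s) * (n : ℝ)⁻¹ *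
      (∫ z in {z : Fin n → ℝ | thresh p n q < ∑ i, z i ^ 2}, (∑ i, z i ^ 2) ∂gaussPi n) +
    (s : ℝ) * (n : ℝ)⁻¹ *
      (∫ z in {z : Fin n → ℝ | thresh p n q < ∑ i, (z i + τ * ℓ i) ^ 2},
        (∑ i, z i ^ 2) ∂gaussPi n)

/-- The threshold `q̃(β, θ, r)` separating the "fat" and "skinny" cases. -/
noncomputable def qTilde (β θ r : ℝ) : ℝ :=
  if β < 1 - θ then max (1 - θ) ((Real.sqrt (1 - β - θ) + Real.sqrt r) ^ 2)
  else 1 - θ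

/-- The set of features selected by χ²-screening, in terms of `(ℓ, μ, Z)`. -/
noncomputable def selSet {n p : ℕ} (q : ℝ) (ℓ : Fin n → ℝ) (μ : Fin p → ℝ)
    (Z : Fin n → Fin p → ℝ) : Finset (Fin p) :=
  chiSel q fun i j => ℓ i * μ j + Z i j

/-- `Z^{(q)} (Z^{(q)})'`. -/
noncomputable def gramZq {n p : ℕ} (q : ℝ) (ℓ : Fin n → ℝ) (μ : Fin p → ℝ)
    (Z : Fin n → Fin p → ℝ) : Matrix (Fin n) (Fin n) ℝ :=
  Matrix.of fun i i' => ∑ j ∈ selSet q ℓ μ Z, Z i j * Z i' j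

/-- `X^{(q)} (X^{(q)})'`. -/
noncomputable def gramXq {n p : ℕ} (q : ℝ) (ℓ : Fin n → ℝ) (μ : Fin p → ℝ)
    (Z : Fin n → Fin p → ℝ) : Matrix (Fin n) (Fin n) ℝ :=
  Matrix.of fun i i' =>
    ∑ j ∈ selSet q ℓ μ Z, (ℓ i * μ j + Z i j) * (ℓ i' * μ j + Z i' j)

/-- The matrix `ℓ (μ^{(q)})' (Z^{(q)})' + Z^{(q)} μ^{(q)} ℓ'`. -/
noncomputable def crossMat {n p : ℕ} (q : ℝ) (ℓ : Fin n → ℝ) (μ : Fin p → ℝ)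
    (Z : Fin n → Fin p → ℝ) : Matrix (Fin n) (Fin n) ℝ :=
  Matrix.of fun i i' =>
    ℓ i * (∑ j ∈ selSet q ℓ μ Z, Z i' j * μ j) +
      (∑ j ∈ selSet q ℓ μ Z, Z i j * μ j) * ℓ i'

/-- Colored-noise data matrix `X = ℓ μ' + A Z B`. -/
noncomputable def dataColored {n p : ℕ} (A : Matrix (Fin n) (Fin n) ℝ)
    (B : Matrix (Fin p) (Fin p) ℝ) (ω : Omega n p) : Fin n → Fin p → ℝ :=
  fun i j => ω.1 i * ω.2.1 j + (A * Matrix.of ω.2.2 * B) i j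

/-- Colored-noise data matrix `X = ℓ μ' + Z B`. -/
noncomputable def dataColoredB {n p : ℕ} (B : Matrix (Fin p) (Fin p) ℝ)
    (ω : Omega n p) : Fin n → Fin p → ℝ :=
  fun i j => ω.1 i * ω.2.1 j + (Matrix.of ω.2.2 * B) i j

/-- `y_*^{(sa)} = n^{-1/2} X' ℓ̂_*^{(sa)}`. -/
noncomputable def ySA {n p : ℕ} (X : Fin n → Fin p → ℝ) : Fin p → ℝ :=
  fun j => (Real.sqrt n)⁻¹ * ∑ i, X i j * ellSimpleAgg X i

/-- `Ŝ_*^{(sa)}`: thresholding `y_*^{(sa)}` at the universal threshold. -/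
noncomputable def ShatSA {n p : ℕ} (X : Fin n → Fin p → ℝ) : Finset (Fin p) :=
  Finset.univ.filter fun j => Real.sqrt (2 * Real.log p) ≤ |ySA X j|

/-- `y_*^{(if)} = n^{-1/2} X' sgn(ξ)` for a given vector `ξ`. -/
noncomputable def yIF {n p : ℕ} (ξ : Fin n → ℝ) (X : Fin n → Fin p → ℝ) : Fin p → ℝ :=
  fun j => (Real.sqrt n)⁻¹ * ∑ i, X i j * Real.sign (ξ i)

/-- `Ŝ_*^{(if)}`: thresholding `y_*^{(if)}` at the universal threshold. -/
noncomputable def ShatIF {n p : ℕ} (ξ : Fin n → ℝ) (X : Fin n → Fin p → ℝ) : Finset (Fin p) :=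
  Finset.univ.filter fun j => Real.sqrt (2 * Real.log p) ≤ |yIF ξ X j|

/-- Rejection region of the Simple Aggregation test `T̂_*^{(sa)}`. -/
noncomputable def rejSA {n p : ℕ} : Set (Fin n → Fin p → ℝ) :=
  {X | 2 * Real.sqrt (2 * Real.log p) ≤
    ((p : ℝ) * (∑ i, ((p : ℝ)⁻¹ * ∑ j, X i j) ^ 2) - n) / Real.sqrt (2 * n)}

/-- Rejection region of the Sparse Aggregation test `T̂_N^{(sa)}`. -/
noncomputable def rejSparse {n p : ℕ} (N : ℕ)
    (S : (Fin n → Fin p → ℝ) → Finset (Fin p)) : Set (Fin n → Fin p → ℝ) :=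
  {X | Real.sqrt (2 / Real.pi) * n + Real.sqrt (2 * n * (N + 2) * Real.log p) ≤
    (Real.sqrt N)⁻¹ * ∑ i, |∑ j ∈ S X, X i j|}

/-- χ² P-value of feature `j`. -/
noncomputable def pvalue {n p : ℕ} (X : Fin n → Fin p → ℝ) (j : Fin p) : ℝ :=
  ((gaussPi n) {z | (∑ i, X i j ^ 2) ≤ ∑ i, z i ^ 2}).toReal

/-- Higher Criticism statistic. -/
noncomputable def HCstat {n p : ℕ} (X : Fin n → Fin p → ℝ) : ℝ :=
  sSup {h : ℝ | ∃ i : Fin p, 2 * (i.val + 1) ≤ p ∧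
    h = Real.sqrt p * (((i.val : ℝ) + 1) / p - pvalue X (Tuple.sort (pvalue X) i)) /
      Real.sqrt (pvalue X (Tuple.sort (pvalue X) i) *
        (1 - pvalue X (Tuple.sort (pvalue X) i)))}

/-- Rejection region of the Higher Criticism test. -/
noncomputable def rejHC {n p : ℕ} : Set (Fin n → Fin p → ℝ) :=
  {X | 2 * Real.sqrt (2 * Real.log (Real.log p)) ≤ HCstat X}

/-- Lebesgue measure on the space of `n × p` matrices. -/
noncomputable def lebPi (n p : ℕ) : Measure (Fin n → Fin p → ℝ) :=
  Measure.pi fun _ : Fin n => Measure.pi fun _ : Fin p => (volume : Measure ℝ)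

/-- Law of `X` in Experiment 1 (`X = ℓ μ' + c_p Z`) with `ℓ_i` forced to be `s`. -/
noncomputable def condLaw1 (n p : ℕ) (ε τ cp : ℝ) (i : Fin n) (s : ℝ) :
    Measure (Fin n → Fin p → ℝ) :=
  (jointLaw n p ε τ).map fun ω => fun i' j =>
    Function.update ω.1 i s i' * ω.2.1 j + cp * ω.2.2 i' j

/-- Law of `X` in Experiment 2 (`X = ℓ μ' + c_p Z + W`) with `ℓ_i` forced to be `s`,
where `W ~ ν` is independent of `(ℓ, μ, Z)`. -/
noncomputable def condLaw2 (n p : ℕ) (ε τ cp : ℝ)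
    (ν : Measure (Fin n → Fin p → ℝ)) (i : Fin n) (s : ℝ) :
    Measure (Fin n → Fin p → ℝ) :=
  ((jointLaw n p ε τ).prod ν).map fun ωw => fun i' j =>
    Function.update ωw.1.1 i s i' * ωw.1.2.1 j + cp * ωw.1.2.2 i' j + ωw.2 i' j

end ARWPaper

namespace ARWPaper

section Deterministic
open Matrix

variable {n p : ℕ}

lemma l2_nonneg (x : Fin n → ℝ) : 0 ≤ l2 x := Real.sqrt_nonneg _

lemma dotProduct_self_eq (x : Fin n → ℝ) : x ⬝ᵥ x = ∑ i, x i ^ 2 := by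
  simp [dotProduct, sq]

lemma l2_sq (x : Fin n → ℝ) : l2 x ^ 2 = x ⬝ᵥ x := by
  rw [dotProduct_self_eq, l2, Real.sq_sqrt (Finset.sum_nonneg fun i _ => sq_nonneg _)]

lemma l2_eq_norm (x : Fin n → ℝ) : l2 x = ‖WithLp.toLp 2 x‖ := by
  rw [EuclideanSpace.norm_eq]; simp [l2]

lemma abs_dotProduct_le (x y : Fin n → ℝ) : |x ⬝ᵥ y| ≤ l2 x * l2 y := by
  have h := abs_real_inner_le_norm (WithLp.toLp 2 x) (WithLp.toLp 2 y)
  rw [l2_eq_norm, l2_eq_norm]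
  convert h using 2
  simp [PiLp.inner_apply, dotProduct, mul_comm]

lemma l2_add_le (x y : Fin n → ℝ) : l2 (x + y) ≤ l2 x + l2 y := by
  simp only [l2_eq_norm, WithLp.toLp_add]; exact norm_add_le _ _

lemma l2_smul (c : ℝ) (x : Fin n → ℝ) : l2 (c • x) = |c| * l2 x := by
  simp only [l2_eq_norm, WithLp.toLp_smul, norm_smul, Real.norm_eq_abs]

lemma abs_apply_le_l2 (x : Fin n → ℝ) (i : Fin n) : |x i| ≤ l2 x := by
  rw [l2_eq_norm]; simpa using PiLp.norm_apply_le (WithLp.toLp 2 x) i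

lemma l2_mono {x y : Fin n → ℝ} (h : ∀ i, |x i| ≤ |y i|) : l2 x ≤ l2 y :=
  Real.sqrt_le_sqrt (Finset.sum_le_sum fun i _ => sq_le_sq.2 (h i))

lemma l2_le_of_abs_le {x : Fin n → ℝ} {c : ℝ} (h : ∀ i, |x i| ≤ c) :
    l2 x ≤ √n * c := by
  by_cases hn : n = 0
  · subst hn; simp [l2]
  have hc : 0 ≤ c := (abs_nonneg _).trans (h ⟨0, Nat.pos_of_ne_zero hn⟩)
  rw [l2, Real.sqrt_le_left (by positivity), mul_pow, Real.sq_sqrt (by positivity)]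
  calc ∑ i, x i ^ 2 ≤ ∑ _i : Fin n, c ^ 2 :=
        Finset.sum_le_sum fun i _ => sq_le_sq' (neg_le_of_abs_le (h i)) (le_of_abs_le (h i))
    _ = n * c ^ 2 := by simp

lemma l2_update_zero_le (x : Fin n → ℝ) (i : Fin n) : l2 (Function.update x i 0) ≤ l2 x := by
  refine l2_mono fun j => ?_
  by_cases h : j = i
  · subst h; simp
  · simp [h]

lemma l2_mulVec_le_of_quadratic {E : Matrix (Fin n) (Fin n) ℝ} (hE : E.IsSymm) {s : ℝ}
    (hs : 0 < s) (h : ∀ x, |x ⬝ᵥ E *ᵥ x| ≤ s * (x ⬝ᵥ x)) (x : Fin n → ℝ) :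
    l2 (E *ᵥ x) ≤ s * l2 x := by
  set y := E *ᵥ x with hy
  have hsym : ∀ u v, u ⬝ᵥ E *ᵥ v = v ⬝ᵥ E *ᵥ u := fun u v => by
    rw [dotProduct_mulVec, ← mulVec_transpose, hE.eq, dotProduct_comm]
  have h1 := (abs_le.1 (h (s • x + y))).2
  have h2 := (abs_le.1 (h (s • x - y))).1
  have e : x ⬝ᵥ E *ᵥ y = y ⬝ᵥ y := by rw [hsym, ← hy]
  have e' : y ⬝ᵥ E *ᵥ x = y ⬝ᵥ y := by rw [← hy]
  simp only [mulVec_add, mulVec_sub, mulVec_smul, add_dotProduct, sub_dotProduct, dotProduct_add,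
    dotProduct_sub, smul_dotProduct, dotProduct_smul, smul_eq_mul, e, e'] at h1 h2
  have e2 : y ⬝ᵥ x = x ⬝ᵥ y := dotProduct_comm _ _
  rw [e2] at h1 h2
  have h3 : s * (y ⬝ᵥ y) ≤ s * (s ^ 2 * (x ⬝ᵥ x)) := by nlinarith
  have h4 := le_of_mul_le_mul_left h3 hs
  rw [← l2_sq, ← l2_sq] at h4
  rw [← mul_pow] at h4
  exact le_of_sq_le_sq h4 (mul_nonneg hs.le (l2_nonneg x))

end Deterministic

section LeaveOneOut
open Matrix

variable {n p : ℕ}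

lemma abs_dotProduct_le_of_fixed_point {F : Matrix (Fin n) (Fin n) ℝ} {r f y : Fin n → ℝ}
    {z s D : ℝ} {K : ℕ} (hz : 0 < z) (hs : 0 ≤ s) (hsz : s ≤ z / 2) (hD : 0 ≤ D)
    (hy : z • y = f + F *ᵥ y)
    (hf : ∀ k < K, |r ⬝ᵥ (F ^ k *ᵥ f)| ≤ s ^ k * D)
    (hK : |r ⬝ᵥ (F ^ K *ᵥ y)| ≤ s ^ (K + 1)) :
    |r ⬝ᵥ y| ≤ 2 * D / z + s * (s / z) ^ K := by
  have key : ∀ k ≤ K, |r ⬝ᵥ y| ≤ (D / z) * ∑ j ∈ Finset.range k, (s / z) ^ j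
      + |r ⬝ᵥ (F ^ k *ᵥ y)| / z ^ k := by
    intro k
    induction k with
    | zero => intro _; simp
    | succ k ih =>
      intro hk
      refine (ih (by omega)).trans ?_
      have e : z * (r ⬝ᵥ (F ^ k *ᵥ y)) = r ⬝ᵥ (F ^ k *ᵥ f) + r ⬝ᵥ (F ^ (k + 1) *ᵥ y) := by
        rw [← smul_eq_mul, ← dotProduct_smul, ← mulVec_smul, hy, mulVec_add, dotProduct_add,
          mulVec_mulVec, pow_succ]
      have h1 : z * |r ⬝ᵥ (F ^ k *ᵥ y)| ≤ s ^ k * D + |r ⬝ᵥ (F ^ (k + 1) *ᵥ y)| := by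
        rw [show z * |r ⬝ᵥ (F ^ k *ᵥ y)| = |z * (r ⬝ᵥ (F ^ k *ᵥ y))| by
          rw [abs_mul, abs_of_pos hz], e]
        exact (abs_add_le _ _).trans (by gcongr; exact hf k (by omega))
      have h2 : |r ⬝ᵥ (F ^ k *ᵥ y)| / z ^ k ≤
          (D / z) * (s / z) ^ k + |r ⬝ᵥ (F ^ (k + 1) *ᵥ y)| / z ^ (k + 1) := by
        rw [div_pow, div_mul_div_comm, ← pow_succ', ← add_div, le_div_iff₀ (by positivity),
          pow_succ, div_mul_eq_mul_div, div_le_iff₀ (by positivity)]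
        nlinarith [pow_pos hz k]
      rw [Finset.sum_range_succ, mul_add]
      linarith
  have hr : s / z ≤ 1 / 2 := by rw [div_le_iff₀ hz]; linarith
  have hr0 : 0 ≤ s / z := by positivity
  have hsum : ∑ j ∈ Finset.range K, (s / z) ^ j ≤ 2 := by
    calc ∑ j ∈ Finset.range K, (s / z) ^ j ≤ ∑ j ∈ Finset.range K, (1 / 2 : ℝ) ^ j := by
          gcongr
      _ ≤ 2 := by
        have := sum_geometric_two_le K
        simpa using this
  refine (key K le_rfl).trans (add_le_add ?_ ?_)
  · rw [mul_comm 2 D, mul_div_right_comm]; gcongr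
  · rw [div_pow, mul_div_assoc', ← pow_succ']; gcongr

/-- The centred Gram matrix `Y Y' - T I`. -/
def centeredGram (T : ℝ) (Y : Matrix (Fin n) (Fin p) ℝ) : Matrix (Fin n) (Fin n) ℝ :=
  Y * Yᵀ - T • (1 : Matrix (Fin n) (Fin n) ℝ)

lemma centeredGram_isSymm (T : ℝ) (Y : Matrix (Fin n) (Fin p) ℝ) :
    (centeredGram T Y).IsSymm := by
  simp [centeredGram, Matrix.IsSymm]

lemma centeredGram_mulVec (T : ℝ) (Y : Matrix (Fin n) (Fin p) ℝ) (u : Fin n → ℝ) :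
    centeredGram T Y *ᵥ u = Y *ᵥ (Yᵀ *ᵥ u) - T • u := by
  simp [centeredGram, sub_mulVec, smul_mulVec]

/-- The matrix `Y` with its `i`-th row erased. -/
noncomputable def eraseRow (i : Fin n) (Y : Matrix (Fin n) (Fin p) ℝ) : Matrix (Fin n) (Fin p) ℝ :=
  Y.updateRow i 0

lemma transpose_eraseRow_mulVec (i : Fin n) (Y : Matrix (Fin n) (Fin p) ℝ) {u : Fin n → ℝ}
    (hu : u i = 0) : (eraseRow i Y)ᵀ *ᵥ u = Yᵀ *ᵥ u := by
  ext j
  simp only [mulVec, dotProduct, transpose_apply, eraseRow]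
  refine Finset.sum_congr rfl fun k _ => ?_
  by_cases h : k = i
  · subst h; simp [hu]
  · simp [updateRow_ne h]

lemma eraseRow_mulVec (i : Fin n) (Y : Matrix (Fin n) (Fin p) ℝ) (v : Fin p → ℝ) :
    eraseRow i Y *ᵥ v = Function.update (Y *ᵥ v) i 0 := by
  ext j
  by_cases h : j = i
  · subst h; simp [eraseRow, mulVec]
  · simp [eraseRow, mulVec, h]

lemma centeredGram_eraseRow_mulVec (T : ℝ) (i : Fin n) (Y : Matrix (Fin n) (Fin p) ℝ)
    {u : Fin n → ℝ} (hu : u i = 0) :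
    centeredGram T (eraseRow i Y) *ᵥ u = Function.update (centeredGram T Y *ᵥ u) i 0 := by
  rw [centeredGram_mulVec, centeredGram_mulVec, transpose_eraseRow_mulVec i Y hu, eraseRow_mulVec]
  ext j
  by_cases h : j = i
  · subst h; simp [hu]
  · simp [h]

lemma centeredGram_eraseRow_pow_mulVec {T s : ℝ} (i : Fin n) {Y : Matrix (Fin n) (Fin p) ℝ}
    (hs : 0 ≤ s) (h : ∀ x, l2 (centeredGram T Y *ᵥ x) ≤ s * l2 x) {u : Fin n → ℝ}
    (hu : u i = 0) (k : ℕ) :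
    (centeredGram T (eraseRow i Y) ^ k *ᵥ u) i = 0 ∧
      l2 (centeredGram T (eraseRow i Y) ^ k *ᵥ u) ≤ s ^ k * l2 u := by
  induction k with
  | zero => simp [hu]
  | succ k ih =>
    rw [pow_succ', ← mulVec_mulVec, centeredGram_eraseRow_mulVec T i Y ih.1]
    refine ⟨by simp, (l2_update_zero_le _ _).trans ((h _).trans ?_)⟩
    rw [pow_succ', mul_assoc]
    gcongr
    exact ih.2

lemma l2_transpose_mulVec_le {T s : ℝ} {Y : Matrix (Fin n) (Fin p) ℝ}
    (h : ∀ x, |x ⬝ᵥ centeredGram T Y *ᵥ x| ≤ s * (x ⬝ᵥ x)) (u : Fin n → ℝ) :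
    l2 (Yᵀ *ᵥ u) ≤ √(s + T) * l2 u := by
  have h1 : (Yᵀ *ᵥ u) ⬝ᵥ (Yᵀ *ᵥ u) ≤ (s + T) * (u ⬝ᵥ u) := by
    have h2 := (abs_le.1 (h u)).2
    rw [centeredGram_mulVec, dotProduct_sub, dotProduct_smul, smul_eq_mul, dotProduct_mulVec,
      ← mulVec_transpose] at h2
    linarith
  rw [← l2_sq, ← l2_sq] at h1
  have h3 := Real.sqrt_le_sqrt h1
  rwa [Real.sqrt_sq (l2_nonneg _), Real.sqrt_mul' _ (sq_nonneg _), Real.sqrt_sq (l2_nonneg _)] at h3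

end LeaveOneOut

section EntrywiseBound
open Matrix

variable {n p : ℕ}

lemma abs_eigenvector_apply_sub_le {T s z a b D₁ D₂ : ℝ} {K : ℕ} (i : Fin n)
    {Y : Matrix (Fin n) (Fin p) ℝ} {ξ ℓ w : Fin n → ℝ}
    (hz : 0 < z) (hs : 0 < s) (hsz : s ≤ z / 2) (hD₁ : 0 ≤ D₁) (hD₂ : 0 ≤ D₂)
    (hE : ∀ x, l2 (centeredGram T Y *ᵥ x) ≤ s * l2 x) (hξ : l2 ξ ≤ 1)
    (heq : z • ξ = a • ℓ + b • w + centeredGram T Y *ᵥ ξ)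
    (hℓ : ∀ k < K, |(centeredGram T Y *ᵥ
      (centeredGram T (eraseRow i Y) ^ k *ᵥ Function.update ℓ i 0)) i| ≤ s ^ k * D₁)
    (hw : ∀ k < K, |(centeredGram T Y *ᵥ
      (centeredGram T (eraseRow i Y) ^ k *ᵥ Function.update w i 0)) i| ≤ s ^ k * D₂) :
    |z * ξ i - a * ℓ i| ≤ |b| * |w i| + 2 * (|a| * D₁ + |b| * D₂) / z
      + (s + 2 * s ^ 2 / z) * |ξ i| + s * (s / z) ^ K := by
  set E := centeredGram T Y with hEdef
  set F := centeredGram T (eraseRow i Y) with hFdef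
  set y := Function.update ξ i 0 with hy
  set e := E *ᵥ (Pi.single i (1 : ℝ)) with he
  set e' := Function.update e i 0 with he'
  have hyi : y i = 0 := by simp [hy]
  have hyl : l2 y ≤ 1 := (l2_update_zero_le _ _).trans hξ
  have hel : l2 e ≤ s := by
    refine (hE _).trans ?_
    have : l2 (Pi.single i (1 : ℝ) : Fin n → ℝ) = 1 := by
      rw [l2_eq_norm]; simp
    rw [this, mul_one]
  have hel' : l2 e' ≤ s := (l2_update_zero_le _ _).trans hel
  have hsplit : ξ = y + ξ i • Pi.single i (1 : ℝ) := by
    ext j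
    by_cases h : j = i
    · subst h; simp [hy]
    · simp [hy, h]
  have hEξ : E *ᵥ ξ = E *ᵥ y + ξ i • e := by
    conv_lhs => rw [hsplit]
    rw [mulVec_add, mulVec_smul]
  have hfix : z • y = (a • Function.update ℓ i 0 + b • Function.update w i 0 + ξ i • e')
      + F *ᵥ y := by
    rw [hFdef, centeredGram_eraseRow_mulVec T i Y hyi]
    ext j
    by_cases h : j = i
    · subst h; simp [hyi, he']
    · have := congrFun heq j
      rw [hEξ] at this
      simp only [Pi.smul_apply, Pi.add_apply, smul_eq_mul] at this
      simp only [Pi.smul_apply, Pi.add_apply, smul_eq_mul, hy, he', Function.update_of_ne h]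
      rw [this]; ring
  have hpow : ∀ (u : Fin n → ℝ) (_ : u i = 0) (k : ℕ),
      |E i ⬝ᵥ (F ^ k *ᵥ u)| ≤ s ^ (k + 1) * l2 u := by
    intro u hu k
    refine (abs_apply_le_l2 (E *ᵥ (F ^ k *ᵥ u)) i).trans ((hE _).trans ?_)
    rw [pow_succ', mul_assoc]
    gcongr
    exact (centeredGram_eraseRow_pow_mulVec i hs.le hE hu k).2
  have hf : ∀ k < K, |E i ⬝ᵥ (F ^ k *ᵥ
      (a • Function.update ℓ i 0 + b • Function.update w i 0 + ξ i • e'))| ≤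
      s ^ k * (|a| * D₁ + |b| * D₂ + s ^ 2 * |ξ i|) := by
    intro k hk
    rw [mulVec_add, mulVec_add, mulVec_smul, mulVec_smul, mulVec_smul, dotProduct_add,
      dotProduct_add, dotProduct_smul, dotProduct_smul, dotProduct_smul, smul_eq_mul, smul_eq_mul,
      smul_eq_mul]
    refine (abs_add_le _ _).trans ((add_le_add_left (abs_add_le _ _) _).trans ?_)
    rw [abs_mul, abs_mul, abs_mul, mul_add, mul_add]
    have h1 := mul_le_mul_of_nonneg_left (hℓ k hk) (abs_nonneg a)
    have h2 := mul_le_mul_of_nonneg_left (hw k hk) (abs_nonneg b)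
    have h3 := mul_le_mul_of_nonneg_left ((hpow e' (by simp [he']) k).trans
      (mul_le_mul_of_nonneg_left hel' (by positivity))) (abs_nonneg (ξ i))
    have h4 : |ξ i| * (s ^ (k + 1) * s) = s ^ k * (s ^ 2 * |ξ i|) := by ring
    have h5 : |a| * (s ^ k * D₁) = s ^ k * (|a| * D₁) := by ring
    have h6 : |b| * (s ^ k * D₂) = s ^ k * (|b| * D₂) := by ring
    rw [h4] at h3; rw [h5] at h1; rw [h6] at h2
    exact add_le_add (add_le_add h1 h2) h3
  have hmain := abs_dotProduct_le_of_fixed_point (r := E i) hz hs.le hsz (by positivity) hfix hf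
    ((hpow y hyi K).trans (mul_le_of_le_one_right (by positivity) hyl))
  have hrow : z * ξ i - a * ℓ i = b * w i + E i ⬝ᵥ y + ξ i * e i := by
    have := congrFun heq i
    rw [hEξ] at this
    simp only [Pi.smul_apply, Pi.add_apply, smul_eq_mul] at this
    have h2 : (E *ᵥ y) i = E i ⬝ᵥ y := rfl
    rw [this, h2]; ring
  have hei : |ξ i * e i| ≤ s * |ξ i| := by
    rw [abs_mul, mul_comm]
    gcongr
    exact (abs_apply_le_l2 e i).trans hel
  rw [hrow]
  calc |b * w i + E i ⬝ᵥ y + ξ i * e i|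
      ≤ |b * w i| + |E i ⬝ᵥ y| + |ξ i * e i| := abs_add_three _ _ _
    _ ≤ |b| * |w i| + (2 * (|a| * D₁ + |b| * D₂ + s ^ 2 * |ξ i|) / z + s * (s / z) ^ K)
        + s * |ξ i| := by
      rw [abs_mul b]; gcongr
    _ = _ := by ring

set_option maxHeartbeats 1000000 in
/-- If the signal strength `n m` dominates the noise level `s` by a factor `κ⁻¹`, then the
rescaled top eigenvector is entrywise `O(κ)`-close to a signed copy of the labels. -/
lemma exists_sign_abs_sub_le {T s z m κ D : ℝ} {K : ℕ} (hn : 0 < n)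
    {Y : Matrix (Fin n) (Fin p) ℝ} {ξ ℓ w : Fin n → ℝ}
    (hℓ1 : ∀ i, ℓ i ^ 2 = 1) (hm : 0 < m) (hκ0 : 0 < κ) (hκ : κ ≤ 1 / 1000)
    (hs : 0 < s) (hsm : s ≤ κ * (n * m)) (hD : 0 ≤ D) (hDm : D ≤ κ * (n * m))
    (hK : √n * (2 * κ) ^ K ≤ 1) (hwi : ∀ i, |w i| ≤ κ * m)
    (hE : ∀ x, |x ⬝ᵥ centeredGram T Y *ᵥ x| ≤ s * (x ⬝ᵥ x)) (hξ : l2 ξ = 1)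
    (heq : z • ξ = (m * (ℓ ⬝ᵥ ξ) + w ⬝ᵥ ξ) • ℓ + (ℓ ⬝ᵥ ξ) • w + centeredGram T Y *ᵥ ξ)
    (hz : m * n ^ 2 + 2 * n * (ℓ ⬝ᵥ w) + ℓ ⬝ᵥ centeredGram T Y *ᵥ ℓ ≤ z * n)
    (hℓ : ∀ i, ∀ k < K, |(centeredGram T Y *ᵥ
      (centeredGram T (eraseRow i Y) ^ k *ᵥ Function.update ℓ i 0)) i| ≤ s ^ k * D)
    (hw : ∀ i, ∀ k < K, |(centeredGram T Y *ᵥ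
      (centeredGram T (eraseRow i Y) ^ k *ᵥ Function.update w i 0)) i| ≤ s ^ k * (κ * m * D)) :
    (∀ i, |√n * ξ i - ℓ i| ≤ 100 * κ) ∨ (∀ i, |√n * ξ i + ℓ i| ≤ 100 * κ) := by
  have hn' : (0 : ℝ) < n := by exact_mod_cast hn
  have hN : (0 : ℝ) < n * m := by positivity
  have hl2 := l2_mulVec_le_of_quadratic (centeredGram_isSymm T Y) hs hE
  have hℓabs : ∀ i, |ℓ i| = 1 := fun i => by
    rw [← sq_eq_sq₀ (abs_nonneg _) zero_le_one, sq_abs, hℓ1, one_pow]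
  have hℓℓ : ℓ ⬝ᵥ ℓ = n := by rw [dotProduct_self_eq]; simp [hℓ1]
  have hsq : √(n : ℝ) ^ 2 = n := Real.sq_sqrt hn'.le
  have hsq0 : 0 < √(n : ℝ) := Real.sqrt_pos.2 hn'
  have hl2ℓ : l2 ℓ = √n := by
    rw [l2, ← dotProduct_self_eq, hℓℓ]
  have hl2w : l2 w ≤ √n * (κ * m) := l2_le_of_abs_le hwi
  have hℓw : |ℓ ⬝ᵥ w| ≤ n * (κ * m) := by
    refine (abs_dotProduct_le _ _).trans ?_
    rw [hl2ℓ]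
    calc √n * l2 w ≤ √n * (√n * (κ * m)) := by gcongr
      _ = n * (κ * m) := by rw [← mul_assoc, ← sq, hsq]
  have hzlow : n * m / 2 ≤ z := by
    have h1 := (abs_le.1 (hE ℓ)).1
    have h2 := (abs_le.1 hℓw).1
    rw [hℓℓ] at h1
    have h3 : 2 * n * (ℓ ⬝ᵥ w) ≥ - (2 * n * (n * (κ * m))) := by nlinarith
    have h4 : s * n ≤ κ * (n * m) * n := by gcongr
    have h5 : (n * m / 2) * n ≤ z * n := by
      have h6 : κ * (m * n ^ 2) ≤ 1 / 1000 * (m * n ^ 2) := by gcongr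
      nlinarith
    exact le_of_mul_le_mul_right h5 hn'
  have hz0 : 0 < z := lt_of_lt_of_le (by positivity) hzlow
  set b := ℓ ⬝ᵥ ξ with hb
  set a := m * b + w ⬝ᵥ ξ with ha
  have hbn : |b| ≤ √n := by
    simpa [hl2ℓ, hξ] using abs_dotProduct_le ℓ ξ
  have hwξ : |w ⬝ᵥ ξ| ≤ √n * (κ * m) := by
    refine (abs_dotProduct_le w ξ).trans ?_
    rwa [hξ, mul_one]
  have han : |a| ≤ 2 * (√n * m) := by
    refine (abs_add_le _ _).trans ?_
    rw [abs_mul, abs_of_pos hm]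
    have h1 : m * |b| ≤ m * √n := by gcongr
    have h2 : κ * (√n * m) ≤ 1 * (√n * m) := by gcongr; linarith
    nlinarith
  have hsz : s / z ≤ 2 * κ := by
    rw [div_le_iff₀ hz0]
    nlinarith
  have hsz' : s ≤ z / 2 := by
    rw [div_le_iff₀ hz0] at hsz; nlinarith
  set c := √n * a / z with hc
  have hc4 : |c| ≤ 4 := by
    rw [hc, abs_div, abs_mul, abs_of_pos hz0, abs_of_pos hsq0, div_le_iff₀ hz0]
    calc √n * |a| ≤ √n * (2 * (√n * m)) := by gcongr
      _ = 2 * (√n ^ 2 * m) := by ring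
      _ ≤ 4 * z := by rw [hsq]; linarith
  have hstep : ∀ i, |√n * ξ i - c * ℓ i| ≤ 28 * κ + 4 * κ * |√n * ξ i| := by
    intro i
    have h := abs_eigenvector_apply_sub_le i hz0 hs hsz' hD
      (by positivity : 0 ≤ κ * m * D) hl2 hξ.le heq (hℓ i) (hw i)
    have e1 : √n * ξ i - c * ℓ i = √n / z * (z * ξ i - a * ℓ i) := by
      rw [hc]; field_simp
    rw [e1, abs_mul, abs_of_pos (by positivity : 0 < √n / z)]
    refine (mul_le_mul_of_nonneg_left h (by positivity)).trans ?_
    have b1 : √n / z * (|b| * |w i|) ≤ 2 * κ := by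
      rw [div_mul_eq_mul_div, div_le_iff₀ hz0]
      calc √n * (|b| * |w i|) ≤ √n * (√n * (κ * m)) := by gcongr; exact hwi i
        _ = κ * (n * m) := by rw [← mul_assoc, ← sq, hsq]; ring
        _ ≤ 2 * κ * z := by nlinarith
    have b2 : √n / z * (2 * (|a| * D + |b| * (κ * m * D)) / z) ≤ 24 * κ := by
      rw [div_mul_div_comm, div_le_iff₀ (by positivity)]
      calc √n * (2 * (|a| * D + |b| * (κ * m * D)))
          ≤ √n * (2 * (2 * (√n * m) * (κ * (n * m)) + √n * (1 * m * (κ * (n * m))))) := by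
            gcongr; linarith
        _ = 6 * κ * (√n ^ 2 * m * (n * m)) := by ring
        _ = 24 * κ * ((n * m / 2) * (n * m / 2)) := by rw [hsq]; ring
        _ ≤ 24 * κ * (z * z) := by gcongr
    have b3 : √n / z * ((s + 2 * s ^ 2 / z) * |ξ i|) ≤ 4 * κ * |√n * ξ i| := by
      rw [abs_mul, abs_of_pos hsq0]
      have : (s + 2 * s ^ 2 / z) / z ≤ 4 * κ := by
        have : (s + 2 * s ^ 2 / z) / z = s / z + 2 * (s / z) * (s / z) := by ring
        rw [this]
        have : 0 ≤ s / z := by positivity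
        nlinarith
      calc √n / z * ((s + 2 * s ^ 2 / z) * |ξ i|)
          = (s + 2 * s ^ 2 / z) / z * (√n * |ξ i|) := by ring
        _ ≤ 4 * κ * (√n * |ξ i|) := by gcongr
    have b4 : √n / z * (s * (s / z) ^ K) ≤ 2 * κ := by
      calc √n / z * (s * (s / z) ^ K) = s / z * (√n * (s / z) ^ K) := by ring
        _ ≤ 2 * κ * (√n * (2 * κ) ^ K) := by gcongr
        _ ≤ 2 * κ := mul_le_of_le_one_right (by positivity) hK
    rw [mul_add, mul_add, mul_add]
    linarith
  have hstep2 : ∀ i, |√n * ξ i - c * ℓ i| ≤ 45 * κ := by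
    intro i
    have h := hstep i
    have h1 : |√n * ξ i| ≤ |√n * ξ i - c * ℓ i| + |c * ℓ i| := by
      have := abs_add_le (√n * ξ i - c * ℓ i) (c * ℓ i)
      simpa using this
    rw [abs_mul c, hℓabs, mul_one] at h1
    have h2 : |√n * ξ i| ≤ 41 / 10 := by nlinarith [abs_nonneg (√n * ξ i)]
    nlinarith
  have hsumξ : ∑ i, |√n * ξ i| ^ 2 = n := by
    have : ξ ⬝ᵥ ξ = 1 := by rw [← l2_sq, hξ, one_pow]
    rw [dotProduct_self_eq] at this
    simp only [sq_abs, mul_pow, hsq]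
    rw [← Finset.mul_sum, this, mul_one]
  have hxc : ∀ i, abs (|√n * ξ i| - |c|) ≤ 45 * κ := by
    intro i
    have h1 := abs_abs_sub_abs_le_abs_sub (√n * ξ i) (c * ℓ i)
    rw [abs_mul c, hℓabs, mul_one] at h1
    exact h1.trans (hstep2 i)
  have hc1 : abs (|c| - 1) ≤ 45 * κ := by
    by_contra! hcon
    have : Nonempty (Fin n) := ⟨⟨0, hn⟩⟩
    rcases lt_abs.1 hcon with h | h
    · have : ∑ _i : Fin n, (1 : ℝ) < ∑ i, |√n * ξ i| ^ 2 := by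
        refine Finset.sum_lt_sum_of_nonempty Finset.univ_nonempty fun i _ => ?_
        have := (abs_le.1 (hxc i)).1
        nlinarith
      rw [hsumξ] at this
      simp at this
    · have : ∑ i, |√n * ξ i| ^ 2 < ∑ _i : Fin n, (1 : ℝ) := by
        refine Finset.sum_lt_sum_of_nonempty Finset.univ_nonempty fun i _ => ?_
        have := (abs_le.1 (hxc i)).2
        have := abs_nonneg (√n * ξ i)
        nlinarith
      rw [hsumξ] at this
      simp at this
  rcases le_total 0 c with h0 | h0
  · left
    intro i
    rw [abs_of_nonneg h0] at hc1
    have : √n * ξ i - ℓ i = (√n * ξ i - c * ℓ i) + (c - 1) * ℓ i := by ring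
    rw [this]
    refine (abs_add_le _ _).trans ?_
    rw [abs_mul (c - 1), hℓabs, mul_one]
    linarith [hstep2 i]
  · right
    intro i
    rw [abs_of_nonpos h0, ← abs_neg] at hc1
    have : √n * ξ i + ℓ i = (√n * ξ i - c * ℓ i) + (-(-c - 1)) * ℓ i := by ring
    rw [this]
    refine (abs_add_le _ _).trans ?_
    rw [abs_mul (-(-c - 1)), hℓabs, mul_one]
    linarith [hstep2 i]

end EntrywiseBound

section TopEigenvector
open Matrix

variable {n p : ℕ}

lemma sum_eigenvalues_mul_dotProduct_sq {A : Matrix (Fin n) (Fin n) ℝ} (hA : A.IsHermitian)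
    (x : Fin n → ℝ) :
    x ⬝ᵥ A *ᵥ x = ∑ k, hA.eigenvalues k * ((hA.eigenvectorBasis k).ofLp ⬝ᵥ x) ^ 2 ∧
      x ⬝ᵥ x = ∑ k, ((hA.eigenvectorBasis k).ofLp ⬝ᵥ x) ^ 2 := by
  have hsym : ∀ u v, u ⬝ᵥ A *ᵥ v = v ⬝ᵥ A *ᵥ u := fun u v => by
    have hs : Aᵀ = A := by rwa [IsHermitian, conjTranspose_eq_transpose_of_trivial] at hA
    rw [dotProduct_mulVec, ← mulVec_transpose, hs, dotProduct_comm]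
  have hin : ∀ u v : EuclideanSpace ℝ (Fin n), inner ℝ u v = u.ofLp ⬝ᵥ v.ofLp := fun u v => by
    simp [PiLp.inner_apply, dotProduct, mul_comm]
  have hexp : ∀ v : Fin n → ℝ, x ⬝ᵥ v =
      ∑ k, (x ⬝ᵥ (hA.eigenvectorBasis k).ofLp) * ((hA.eigenvectorBasis k).ofLp ⬝ᵥ v) := by
    intro v
    have := hA.eigenvectorBasis.sum_inner_mul_inner (WithLp.toLp 2 x) (WithLp.toLp 2 v)
    simp only [hin] at this
    exact this.symm
  constructor
  · rw [hexp]
    refine Finset.sum_congr rfl fun k _ => ?_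
    rw [hsym, hA.mulVec_eigenvectorBasis, dotProduct_smul, smul_eq_mul, dotProduct_comm x]
    ring
  · rw [hexp]
    refine Finset.sum_congr rfl fun k _ => ?_
    rw [dotProduct_comm x]; ring

lemma dotProduct_mulVec_le_of_eigenvalue_le {A : Matrix (Fin n) (Fin n) ℝ} (hA : A.IsHermitian)
    {lam : ℝ} (h : ∀ (lam' : ℝ) (v : Fin n → ℝ), v ≠ 0 → A *ᵥ v = lam' • v → lam' ≤ lam)
    (x : Fin n → ℝ) : x ⬝ᵥ A *ᵥ x ≤ lam * (x ⬝ᵥ x) := by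
  obtain ⟨h1, h2⟩ := sum_eigenvalues_mul_dotProduct_sq hA x
  rw [h1, h2, Finset.mul_sum]
  refine Finset.sum_le_sum fun k _ => mul_le_mul_of_nonneg_right ?_ (sq_nonneg _)
  refine h _ (hA.eigenvectorBasis k).ofLp ?_ (hA.mulVec_eigenvectorBasis k)
  intro h0
  have := hA.eigenvectorBasis.orthonormal.ne_zero k
  exact this (by ext i; simpa using congrFun h0 i)

lemma gram_dataColoredB_mulVec (B : Matrix (Fin p) (Fin p) ℝ) (ω : Omega n p) (T : ℝ)
    (v : Fin n → ℝ) :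
    gram (dataColoredB B ω) *ᵥ v =
      ((ω.2.1 ⬝ᵥ ω.2.1) * (ω.1 ⬝ᵥ v) + ((Matrix.of ω.2.2 * B) *ᵥ ω.2.1) ⬝ᵥ v) • ω.1
        + (ω.1 ⬝ᵥ v) • ((Matrix.of ω.2.2 * B) *ᵥ ω.2.1)
        + centeredGram T (Matrix.of ω.2.2 * B) *ᵥ v + T • v := by
  set Y := Matrix.of ω.2.2 * B with hY
  have hX : (gram (dataColoredB B ω)) = (vecMulVec ω.1 ω.2.1 + Y) * (vecMulVec ω.1 ω.2.1 + Y)ᵀ := by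
    ext i j
    simp only [gram, dataColoredB, Matrix.mul_apply, hY, of_apply, transpose_apply,
      Matrix.add_apply,
      vecMulVec_apply]
  rw [hX, ← mulVec_mulVec, transpose_add, add_mulVec, transpose_vecMulVec, add_mulVec,
    mulVec_add, mulVec_add, vecMulVec_mulVec, vecMulVec_mulVec, vecMulVec_mulVec,
    centeredGram_mulVec]
  have e : (ω.2.1 ⬝ᵥ Yᵀ *ᵥ v) = (Y *ᵥ ω.2.1) ⬝ᵥ v := by
    rw [dotProduct_mulVec, vecMul_transpose]
  simp only [op_smul_eq_smul, mulVec_smul, dotProduct_smul, smul_eq_mul, e]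
  ext i
  simp only [Pi.add_apply, Pi.smul_apply, Pi.sub_apply, smul_eq_mul]
  ring

lemma IsTopEigenvector.exists_shifted_eigenvalue {B : Matrix (Fin p) (Fin p) ℝ} {ω : Omega n p}
    {ξ : Fin n → ℝ} (T : ℝ) (hξ : IsTopEigenvector (gram (dataColoredB B ω)) ξ) :
    l2 ξ = 1 ∧ ∃ z : ℝ,
      z • ξ = ((ω.2.1 ⬝ᵥ ω.2.1) * (ω.1 ⬝ᵥ ξ) + ((Matrix.of ω.2.2 * B) *ᵥ ω.2.1) ⬝ᵥ ξ) • ω.1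
        + (ω.1 ⬝ᵥ ξ) • ((Matrix.of ω.2.2 * B) *ᵥ ω.2.1)
        + centeredGram T (Matrix.of ω.2.2 * B) *ᵥ ξ ∧
      (ω.2.1 ⬝ᵥ ω.2.1) * (ω.1 ⬝ᵥ ω.1) ^ 2
        + 2 * (ω.1 ⬝ᵥ ω.1) * (ω.1 ⬝ᵥ ((Matrix.of ω.2.2 * B) *ᵥ ω.2.1))
        + ω.1 ⬝ᵥ centeredGram T (Matrix.of ω.2.2 * B) *ᵥ ω.1 ≤ z * (ω.1 ⬝ᵥ ω.1) := by
  obtain ⟨h1, lam, h2, h3⟩ := hξ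
  have hA : (gram (dataColoredB B ω)).IsHermitian := by
    ext i j
    simp [gram, mul_comm]
  refine ⟨by rw [l2, h1, Real.sqrt_one], lam - T, ?_, ?_⟩
  · rw [sub_smul, ← h2, gram_dataColoredB_mulVec B ω T]
    simp
  · have h4 := dotProduct_mulVec_le_of_eigenvalue_le hA h3 ω.1
    rw [gram_dataColoredB_mulVec B ω T] at h4
    simp only [dotProduct_add, dotProduct_smul, smul_eq_mul] at h4
    rw [dotProduct_comm ((Matrix.of ω.2.2 * B) *ᵥ ω.2.1)] at h4
    linarith

end TopEigenvector

section OperatorBounds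
open Matrix

variable {n p : ℕ}

lemma bddAbove_specNorm {m k : ℕ} (A : Matrix (Fin m) (Fin k) ℝ) :
    BddAbove ((fun v => l2 (A.mulVec v)) '' {v | l2 v ≤ 1}) := by
  refine ⟨‖(Matrix.toEuclideanLin A).toContinuousLinearMap‖, ?_⟩
  rintro _ ⟨v, hv, rfl⟩
  have h := (Matrix.toEuclideanLin A).toContinuousLinearMap.le_opNorm (WithLp.toLp 2 v)
  have h1 : l2 (A *ᵥ v) = ‖(Matrix.toEuclideanLin A).toContinuousLinearMap (WithLp.toLp 2 v)‖ := by
    rw [l2_eq_norm]; rfl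
  have hv' : l2 v ≤ 1 := hv
  rw [l2_eq_norm] at hv'
  simp only [h1]
  exact h.trans (mul_le_of_le_one_right (norm_nonneg _) hv')

lemma l2_mulVec_le_specNorm {m k : ℕ} (A : Matrix (Fin m) (Fin k) ℝ) (v : Fin k → ℝ) :
    l2 (A *ᵥ v) ≤ specNorm A * l2 v := by
  rcases (l2_nonneg v).eq_or_lt with h | h
  · have hv : v = 0 := by
      have := l2_eq_norm v
      rw [← h] at this
      have := norm_eq_zero.1 this.symm
      ext i; simpa using congrArg (fun u => u i) this
    subst hv
    simp [l2]
  · have h1 : l2 (A *ᵥ ((l2 v)⁻¹ • v)) ≤ specNorm A := by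
      refine le_csSup (bddAbove_specNorm A) ⟨_, ?_, rfl⟩
      show l2 _ ≤ 1
      rw [l2_smul, abs_of_pos (by positivity), inv_mul_cancel₀ h.ne']
    rw [mulVec_smul, l2_smul, abs_of_pos (by positivity), inv_mul_le_iff₀ h] at h1
    linarith

lemma l2_transpose_mulVec_le_of_l2_mulVec_le {m k : ℕ} {A : Matrix (Fin m) (Fin k) ℝ} {c : ℝ}
    (hc : 0 ≤ c) (h : ∀ v, l2 (A *ᵥ v) ≤ c * l2 v) (v : Fin m → ℝ) : l2 (Aᵀ *ᵥ v) ≤ c * l2 v := by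
  have h1 : l2 (Aᵀ *ᵥ v) ^ 2 ≤ l2 v * (c * l2 (Aᵀ *ᵥ v)) := by
    rw [l2_sq, dotProduct_mulVec, vecMul_transpose, dotProduct_comm]
    exact (le_abs_self _).trans ((abs_dotProduct_le _ _).trans
      (mul_le_mul_of_nonneg_left (h _) (l2_nonneg _)))
  rcases (l2_nonneg (Aᵀ *ᵥ v)).eq_or_lt with h0 | h0
  · rw [← h0]
    exact mul_nonneg hc (l2_nonneg _)
  · nlinarith

lemma exists_abs_dotProduct_mulVec_eq (hn : 0 < n) (E : Matrix (Fin n) (Fin n) ℝ) :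
    ∃ x : Fin n → ℝ, l2 x = 1 ∧
      ∀ v : Fin n → ℝ, |v ⬝ᵥ E *ᵥ v| ≤ |x ⬝ᵥ E *ᵥ x| * (v ⬝ᵥ v) := by
  have : Nonempty (Fin n) := ⟨⟨0, hn⟩⟩
  have hne : (Metric.sphere (0 : EuclideanSpace ℝ (Fin n)) 1).Nonempty :=
    NormedSpace.sphere_nonempty.2 zero_le_one
  obtain ⟨x, hx, hmax⟩ := (isCompact_sphere (0 : EuclideanSpace ℝ (Fin n)) 1).exists_isMaxOn hne
    (f := fun x => |x.ofLp ⬝ᵥ E *ᵥ x.ofLp|) (by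
      apply Continuous.continuousOn
      simp only [dotProduct, mulVec]
      fun_prop)
  refine ⟨x.ofLp, ?_, fun v => ?_⟩
  · rw [l2_eq_norm]; simpa using hx
  · rcases (l2_nonneg v).eq_or_lt with h | h
    · have hv : v ⬝ᵥ v = 0 := by rw [← l2_sq, ← h]; simp
      have : v = 0 := dotProduct_self_eq_zero.1 hv
      simp [this]
    · have h1 := hmax (a := WithLp.toLp 2 ((l2 v)⁻¹ • v)) (by
        rw [mem_sphere_zero_iff_norm, ← l2_eq_norm, l2_smul, abs_of_pos (by positivity),
          inv_mul_cancel₀ h.ne'])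
      have h2 : |((l2 v)⁻¹ • v) ⬝ᵥ E *ᵥ ((l2 v)⁻¹ • v)| ≤ |x.ofLp ⬝ᵥ E *ᵥ x.ofLp| := h1
      rw [mulVec_smul, smul_dotProduct, dotProduct_smul, smul_smul, smul_eq_mul, abs_mul,
        abs_of_pos (by positivity), ← mul_inv, inv_mul_le_iff₀ (by positivity)] at h2
      rw [← l2_sq]
      linarith

/-- A point of the grid of mesh `1 / (8n)` in the cube `[-1, 1]^n`. -/
noncomputable def gridPoint {n : ℕ} (f : Fin n → Fin (16 * n + 1)) : Fin n → ℝ :=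
  fun i => ((f i : ℕ) - 8 * n : ℝ) / (8 * n)

lemma exists_gridPoint_close (hn : 0 < n) {x : Fin n → ℝ} (hx : ∀ i, |x i| ≤ 1) :
    ∃ f, ∀ i, |x i - gridPoint f i| ≤ 1 / (8 * n) := by
  have hn' : (0 : ℝ) < n := by exact_mod_cast hn
  have key : ∀ i, ∃ k : Fin (16 * n + 1),
      |x i - ((k : ℕ) - 8 * n : ℝ) / (8 * n)| ≤ 1 / (8 * n) := by
    intro i
    obtain ⟨h1, h2⟩ := abs_le.1 (hx i)
    have h0 : 0 ≤ 8 * n * (x i + 1) := by apply mul_nonneg <;> linarith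
    have hfl := Nat.floor_le h0
    have hlt := Nat.lt_floor_add_one (8 * n * (x i + 1))
    refine ⟨⟨⌊8 * n * (x i + 1)⌋₊, ?_⟩, ?_⟩
    · have : (⌊8 * n * (x i + 1)⌋₊ : ℝ) ≤ (16 * n : ℕ) := by
        push_cast; nlinarith
      have := Nat.cast_le.1 this
      omega
    · have : x i - ((⌊8 * n * (x i + 1)⌋₊ : ℝ) - 8 * n) / (8 * n)
          = (8 * n * (x i + 1) - ⌊8 * n * (x i + 1)⌋₊) / (8 * n) := by field_simp; ring
      simp only
      rw [this, abs_div, abs_of_pos (by positivity : (0 : ℝ) < 8 * n)]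
      gcongr
      rw [abs_le]; constructor <;> linarith
  choose f hf using key
  exact ⟨f, hf⟩

lemma abs_quadratic_le_of_gridPoint (hn : 0 < n) {E : Matrix (Fin n) (Fin n) ℝ} (hE : E.IsSymm)
    {s : ℝ} (hs : 0 ≤ s)
    (h : ∀ f : Fin n → Fin (16 * n + 1),
      |gridPoint f ⬝ᵥ E *ᵥ gridPoint f| ≤ s * (gridPoint f ⬝ᵥ gridPoint f)) (v : Fin n → ℝ) :
    |v ⬝ᵥ E *ᵥ v| ≤ 2 * s * (v ⬝ᵥ v) := by
  obtain ⟨x, hx, hmax⟩ := exists_abs_dotProduct_mulVec_eq hn E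
  set S := |x ⬝ᵥ E *ᵥ x| with hS
  have hS0 : 0 ≤ S := abs_nonneg _
  refine (hmax v).trans (mul_le_mul_of_nonneg_right ?_ (by rw [← l2_sq]; positivity))
  rcases hS0.eq_or_lt with h0 | hSpos
  · rw [← h0]; linarith
  have hn' : (1 : ℝ) ≤ n := by exact_mod_cast hn
  obtain ⟨f, hf⟩ := exists_gridPoint_close hn (x := x) (fun i => (abs_apply_le_l2 x i).trans hx.le)
  set y := gridPoint f
  have hop := l2_mulVec_le_of_quadratic hE hSpos hmax
  have hxy : l2 (x - y) ≤ 1 / 8 := by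
    refine (l2_le_of_abs_le (c := 1 / (8 * n)) hf).trans ?_
    have : √(n : ℝ) ≤ n := by
      rw [Real.sqrt_le_left (by linarith)]; nlinarith
    rw [mul_one_div, div_le_div_iff₀ (by positivity) (by norm_num)]
    linarith
  have hy : l2 y ≤ 9 / 8 := by
    have : y = x + (-1 : ℝ) • (x - y) := by simp
    rw [this]
    refine (l2_add_le _ _).trans ?_
    rw [l2_smul, hx]; norm_num; linarith
  have hxy' : l2 (x + y) ≤ 17 / 8 := by
    refine (l2_add_le _ _).trans ?_
    rw [hx]; linarith
  have hsymm : x ⬝ᵥ E *ᵥ y = y ⬝ᵥ E *ᵥ x := by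
    rw [dotProduct_mulVec, ← mulVec_transpose, hE.eq, dotProduct_comm]
  have hdecomp : x ⬝ᵥ E *ᵥ x = y ⬝ᵥ E *ᵥ y + (x - y) ⬝ᵥ E *ᵥ (x + y) := by
    simp only [mulVec_add, sub_dotProduct, dotProduct_add, hsymm]; ring
  have h1 : |(x - y) ⬝ᵥ E *ᵥ (x + y)| ≤ 1 / 8 * (S * (17 / 8)) := by
    refine (abs_dotProduct_le _ _).trans ?_
    exact mul_le_mul hxy ((hop _).trans (mul_le_mul_of_nonneg_left hxy' hS0)) (l2_nonneg _)
      (by norm_num)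
  have h2 : |y ⬝ᵥ E *ᵥ y| ≤ s * (9 / 8) ^ 2 := by
    refine (h f).trans (mul_le_mul_of_nonneg_left ?_ hs)
    rw [← l2_sq]
    exact pow_le_pow_left₀ (l2_nonneg _) hy 2
  have h3 : S ≤ |y ⬝ᵥ E *ᵥ y| + |(x - y) ⬝ᵥ E *ᵥ (x + y)| := by
    rw [hS, hdecomp]; exact abs_add_le _ _
  linarith

end OperatorBounds

section Tails
open Matrix

variable {n p : ℕ}

lemma measureReal_pi_le_sum_le {ι : Type*} [Fintype ι] {μ : ι → Measure ℝ}
    [∀ i, IsProbabilityMeasure (μ i)] (f : ι → ℝ → ℝ) (c : ι → ℝ) (a : ℝ)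
    (hf : ∀ i, Integrable (fun x => Real.exp (f i x)) (μ i))
    (hc : ∀ i, ∫ x, Real.exp (f i x) ∂(μ i) ≤ Real.exp (c i)) :
    (Measure.pi μ).real {x | a ≤ ∑ i, f i (x i)} ≤ Real.exp (∑ i, c i - a) := by
  have h_int : Integrable (fun x : ι → ℝ => Real.exp (1 * ∑ i, f i (x i))) (Measure.pi μ) := by
    simp only [one_mul, Real.exp_sum]
    exact Integrable.fintype_prod_dep hf
  have h := measure_ge_le_exp_mul_mgf (μ := Measure.pi μ) (X := fun x => ∑ i, f i (x i)) a
    zero_le_one h_int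
  refine h.trans ?_
  have : mgf (fun x : ι → ℝ => ∑ i, f i (x i)) (Measure.pi μ) 1
      = ∏ i, ∫ x, Real.exp (f i x) ∂(μ i) := by
    simp only [mgf, one_mul, Real.exp_sum]
    exact integral_fintype_prod_eq_prod (fun i x => Real.exp (f i x))
  rw [this, sub_eq_add_neg, add_comm, Real.exp_add, neg_one_mul, Real.exp_sum]
  refine mul_le_mul_of_nonneg_left (Finset.prod_le_prod (fun i _ => ?_) fun i _ => hc i)
    (Real.exp_pos _).le
  exact integral_nonneg fun _ => (Real.exp_pos _).le

instance : IsProbabilityMeasure (gaussPi p) := by unfold gaussPi; infer_instance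

instance : IsProbabilityMeasure (noiseLaw n p) := by unfold noiseLaw; infer_instance

instance : IsProbabilityMeasure signLaw := ⟨by
  simp only [signLaw, Measure.coe_add, Measure.coe_smul, Pi.add_apply, Pi.smul_apply, measure_univ,
    smul_eq_mul, mul_one, one_div, ENNReal.inv_two_add_inv_two]⟩

lemma isProbabilityMeasure_muLaw {ε τ : ℝ} (h0 : 0 ≤ ε) (h1 : ε ≤ 1) :
    IsProbabilityMeasure (muLaw ε τ) := ⟨by
  simp only [muLaw, Measure.coe_add, Measure.coe_smul, Pi.add_apply, Pi.smul_apply, measure_univ,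
    smul_eq_mul, mul_one]
  rw [← ENNReal.ofReal_add (by linarith) h0]; simp⟩

lemma gaussPi_real_le_dotProduct_le (g : Fin p → ℝ) {r t : ℝ} (hr : l2 g ≤ r) (hr0 : 0 < r)
    (ht : 0 ≤ t) :
    (gaussPi p).real {z | t * r ≤ z ⬝ᵥ g} ≤ Real.exp (-t ^ 2 / 2) := by
  have h := measureReal_pi_le_sum_le (μ := fun _ : Fin p => gaussianReal 0 1)
    (fun j x => t / r * g j * x) (fun j => (t / r * g j) ^ 2 / 2) (t ^ 2)
    (fun j => integrable_exp_mul_gaussianReal _) (fun j => by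
      have := congrFun (mgf_id_gaussianReal (μ := 0) (v := 1)) (t / r * g j)
      simp only [mgf, id] at this
      rw [this]; simp)
  have hset : {z : Fin p → ℝ | t * r ≤ z ⬝ᵥ g} ⊆
      {x | t ^ 2 ≤ ∑ j, t / r * g j * x j} := by
    intro z hz
    have : ∑ j, t / r * g j * z j = t / r * (z ⬝ᵥ g) := by
      rw [dotProduct, Finset.mul_sum]; exact Finset.sum_congr rfl fun j _ => by ring
    simp only [Set.mem_ofPred_eq] at hz ⊢
    rw [this]
    calc t ^ 2 = t / r * (t * r) := by field_simp
      _ ≤ _ := by gcongr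
  refine (measureReal_mono hset).trans (h.trans (Real.exp_le_exp.2 ?_))
  have h1 : ∑ j, (t / r * g j) ^ 2 / 2 = t ^ 2 / 2 * (l2 g / r) ^ 2 := by
    rw [div_pow (l2 g), l2_sq, dotProduct_self_eq, Finset.sum_div, Finset.mul_sum]
    exact Finset.sum_congr rfl fun j _ => by ring
  have h2 : (l2 g / r) ^ 2 ≤ 1 := by
    rw [sq_le_one_iff_abs_le_one, abs_of_nonneg (div_nonneg (l2_nonneg _) hr0.le), div_le_one hr0]
    exact hr
  rw [h1]
  nlinarith [sq_nonneg t]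

lemma gaussPi_lt_abs_dotProduct_le (g : Fin p → ℝ) {t : ℝ} (ht : 0 ≤ t) :
    gaussPi p {z | t * l2 g < |z ⬝ᵥ g|} ≤ ENNReal.ofReal (2 * Real.exp (-t ^ 2 / 2)) := by
  rcases (l2_nonneg g).eq_or_lt with h | h
  · have : g = 0 := dotProduct_self_eq_zero.1 (by rw [← l2_sq, ← h]; simp)
    subst this
    simp [← h]
  · have hsub : {z : Fin p → ℝ | t * l2 g < |z ⬝ᵥ g|} ⊆
        {z | t * l2 g ≤ z ⬝ᵥ g} ∪ {z | t * l2 (-g) ≤ z ⬝ᵥ (-g)} := by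
      have hneg : l2 (-g) = l2 g := by simp [l2]
      intro z hz
      simp only [Set.mem_ofPred_eq, Set.mem_union, dotProduct_neg, hneg] at hz ⊢
      rcases lt_abs.1 hz with h | h
      · exact Or.inl h.le
      · exact Or.inr h.le
    refine (measure_mono hsub).trans ((measure_union_le _ _).trans ?_)
    have hneg : l2 (-g) = l2 g := by simp [l2]
    have h1 := gaussPi_real_le_dotProduct_le g le_rfl h ht
    have h2 := gaussPi_real_le_dotProduct_le (-g) le_rfl (hneg ▸ h) ht
    rw [two_mul, ENNReal.ofReal_add (Real.exp_pos _).le (Real.exp_pos _).le]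
    refine add_le_add ?_ ?_
    · rw [← ofReal_measureReal]; exact ENNReal.ofReal_le_ofReal h1
    · rw [← ofReal_measureReal]; exact ENNReal.ofReal_le_ofReal h2

end Tails

section HansonWright
open Matrix

variable {n p : ℕ}

lemma integrable_exp_mul_sq_sub_one_gaussianReal {s : ℝ} (hs : |s| ≤ 1 / 4) :
    Integrable (fun x => Real.exp (s * (x ^ 2 - 1))) (gaussianReal 0 1) ∧
      ∫ x, Real.exp (s * (x ^ 2 - 1)) ∂(gaussianReal 0 1) ≤ Real.exp (4 * s ^ 2) := by
  obtain ⟨hs1, hs2⟩ := abs_le.1 hs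
  have hform : (fun x => gaussianPDFReal 0 1 x • Real.exp (s * (x ^ 2 - 1)))
      = fun x => (√(2 * Real.pi))⁻¹ * Real.exp (-s) * Real.exp (-(1 / 2 - s) * x ^ 2) := by
    ext x
    simp only [gaussianPDFReal, NNReal.coe_one, mul_one, sub_zero, smul_eq_mul]
    rw [mul_assoc, mul_assoc, ← Real.exp_add, ← Real.exp_add]
    ring_nf
  constructor
  · rw [gaussianReal_of_var_ne_zero _ one_ne_zero, integrable_withDensity_iff_integrable_smul'
      (measurable_gaussianPDF _ _) (ae_of_all _ fun _ => gaussianPDF_lt_top)]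
    simp only [toReal_gaussianPDF]
    rw [hform]
    exact (integrable_exp_neg_mul_sq (by linarith)).const_mul _
  · rw [integral_gaussianReal_eq_integral_smul one_ne_zero, hform, integral_const_mul,
      integral_gaussian]
    have h1 : √(Real.pi / (1 / 2 - s)) = √(2 * Real.pi) * √(1 / (1 - 2 * s)) := by
      rw [← Real.sqrt_mul (by positivity)]
      congr 1
      have : (1 : ℝ) - 2 * s ≠ 0 := by linarith
      have : (1 : ℝ) / 2 - s ≠ 0 := by linarith
      field_simp
    have h2 : √(2 * Real.pi) ≠ 0 := by positivity
    rw [h1]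
    have h3 : √(1 / (1 - 2 * s)) ≤ Real.exp (s + 4 * s ^ 2) := by
      rw [Real.sqrt_le_left (Real.exp_pos _).le, ← Real.exp_nat_mul,
        div_le_iff₀ (by linarith)]
      have := Real.add_one_le_exp (((2 : ℕ) : ℝ) * (s + 4 * s ^ 2))
      push_cast at this ⊢
      have h4 : (1 : ℝ) ≤ (2 * (s + 4 * s ^ 2) + 1) * (1 - 2 * s) := by
        nlinarith [mul_nonneg (sq_nonneg s) (by linarith : 0 ≤ 1 / 4 - s)]
      exact h4.trans (mul_le_mul_of_nonneg_right this (by linarith))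
    calc (√(2 * Real.pi))⁻¹ * Real.exp (-s) * (√(2 * Real.pi) * √(1 / (1 - 2 * s)))
        = Real.exp (-s) * √(1 / (1 - 2 * s)) := by field_simp
      _ ≤ Real.exp (-s) * Real.exp (s + 4 * s ^ 2) := by gcongr
      _ = _ := by rw [← Real.exp_add]; ring_nf

lemma noiseLaw_map_eq_gaussPi {y : Fin n → ℝ} (hy : y ⬝ᵥ y = 1) {u : Fin p → Fin p → ℝ}
    (hu : ∀ t : Fin p → ℝ, (∑ k, t k • u k) ⬝ᵥ (∑ k, t k • u k) = t ⬝ᵥ t) :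
    (noiseLaw n p).map (fun Z k => y ⬝ᵥ (Matrix.of Z *ᵥ u k)) = gaussPi p := by
  have hmeas : Measurable (fun (Z : Fin n → Fin p → ℝ) k => y ⬝ᵥ (Matrix.of Z *ᵥ u k)) := by
    simp only [dotProduct, mulVec, of_apply]
    fun_prop
  have := Measure.isProbabilityMeasure_map (μ := noiseLaw n p) hmeas.aemeasurable
  refine (charFun_eq_pi_iff (μ := fun _ : Fin p => gaussianReal 0 1)).1 fun t => ?_
  rw [charFun_apply, Measure.map_map (by fun_prop) hmeas, integral_map
    ((WithLp.measurable_toLp 2 _).comp hmeas).aemeasurable (by fun_prop)]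
  set v : Fin p → ℝ := ∑ k, t k • u k with hv
  have hin : ∀ Z : Fin n → Fin p → ℝ, inner ℝ (WithLp.toLp 2 fun k => y ⬝ᵥ (Matrix.of Z *ᵥ u k)) t
      = ∑ i, ∑ j, (y i * v j) * Z i j := by
    intro Z
    have : inner ℝ (WithLp.toLp 2 fun k => y ⬝ᵥ (Matrix.of Z *ᵥ u k)) t
        = y ⬝ᵥ (Matrix.of Z *ᵥ v) := by
      rw [hv, mulVec_sum, dotProduct_sum]
      simp [PiLp.inner_apply, mulVec_smul]
    rw [this]
    simp only [dotProduct, mulVec, of_apply, Finset.mul_sum]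
    exact Finset.sum_congr rfl fun i _ => Finset.sum_congr rfl fun j _ => by ring
  have hchar : ∀ a : ℝ, ∫ x : ℝ, Complex.exp ((a * x : ℝ) * Complex.I) ∂(gaussianReal 0 1)
      = Complex.exp (-(a ^ 2 / 2 : ℝ)) := by
    intro a
    have h := charFun_gaussianReal (μ := 0) (v := 1) a
    rw [charFun_apply] at h
    simp only [RCLike.inner_apply, conj_trivial] at h
    rw [h]; congr 1; simp
  simp only [Function.comp_apply, hin, charFun_gaussianReal]
  have hprod : ∀ Z : Fin n → Fin p → ℝ,
      Complex.exp ((∑ i, ∑ j, (y i * v j) * Z i j : ℝ) * Complex.I)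
      = ∏ i, ∏ j, Complex.exp (((y i * v j) * Z i j : ℝ) * Complex.I) := by
    intro Z
    simp only [Complex.ofReal_sum, Finset.sum_mul, Complex.exp_sum]
  simp only [hprod]
  have h1 : ∫ Z, ∏ i, ∏ j, Complex.exp (((y i * v j) * Z i j : ℝ) * Complex.I) ∂(noiseLaw n p)
      = ∏ i, ∏ j, Complex.exp (-((y i * v j) ^ 2 / 2 : ℝ)) := by
    rw [noiseLaw, integral_fintype_prod_eq_prod
      (f := fun i (z : Fin p → ℝ) => ∏ j, Complex.exp (((y i * v j) * z j : ℝ) * Complex.I))]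
    refine Finset.prod_congr rfl fun i _ => ?_
    rw [gaussPi, integral_fintype_prod_eq_prod
      (f := fun j (z : ℝ) => Complex.exp (((y i * v j) * z : ℝ) * Complex.I))]
    exact Finset.prod_congr rfl fun j _ => hchar _
  rw [h1]
  simp only [← Complex.exp_sum]
  congr 1
  have hvt : v ⬝ᵥ v = t.ofLp ⬝ᵥ t.ofLp := hu _
  have h2 : ∑ i, ∑ j, (y i * v j) ^ 2 / 2 = ∑ j, (t j) ^ 2 / 2 := by
    have : ∑ i, ∑ j, (y i * v j) ^ 2 / 2 = (y ⬝ᵥ y) * (v ⬝ᵥ v) / 2 := by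
      rw [dotProduct_self_eq, dotProduct_self_eq, Finset.sum_mul_sum, Finset.sum_div]
      refine Finset.sum_congr rfl fun i _ => ?_
      rw [Finset.sum_div]
      exact Finset.sum_congr rfl fun j _ => by ring
    rw [this, hy, hvt, dotProduct_self_eq, one_mul, Finset.sum_div]
  have h3 : ∑ i, ∑ j, (-(((y i * v j) ^ 2 / 2 : ℝ) : ℂ)) =
      -((∑ i, ∑ j, (y i * v j) ^ 2 / 2 : ℝ) : ℂ) := by
    push_cast; simp only [Finset.sum_neg_distrib]
  rw [h3, h2]
  push_cast
  rw [← Finset.sum_neg_distrib]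
  refine Finset.sum_congr rfl fun j _ => ?_
  simp

lemma measure_le_ofReal_of_measureReal_le {Ω : Type*} [MeasurableSpace Ω] {μ : Measure Ω}
    [IsFiniteMeasure μ] {A : Set Ω} {c : ℝ} (h : μ.real A ≤ c) : μ A ≤ ENNReal.ofReal c := by
  rw [← ofReal_measureReal]; exact ENNReal.ofReal_le_ofReal h

lemma gaussPi_lt_abs_sum_mul_sq_sub_one_le (d : Fin p → ℝ) {r a : ℝ}
    (hd : ∀ k, |r * d k| ≤ 1 / 4) (hr : 0 < r) :
    gaussPi p {x | a < |∑ k, d k * (x k ^ 2 - 1)|} ≤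
      ENNReal.ofReal (2 * Real.exp (4 * ∑ k, (r * d k) ^ 2 - r * a)) := by
  have key : ∀ e : Fin p → ℝ, (∀ k, |r * e k| ≤ 1 / 4) →
      (gaussPi p).real {x | a ≤ ∑ k, e k * (x k ^ 2 - 1)} ≤
        Real.exp (4 * ∑ k, (r * e k) ^ 2 - r * a) := by
    intro e he
    have h := measureReal_pi_le_sum_le (μ := fun _ : Fin p => gaussianReal 0 1)
      (fun k x => r * e k * (x ^ 2 - 1)) (fun k => 4 * (r * e k) ^ 2) (r * a)
      (fun k => (integrable_exp_mul_sq_sub_one_gaussianReal (he k)).1)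
      (fun k => (integrable_exp_mul_sq_sub_one_gaussianReal (he k)).2)
    rw [← Finset.mul_sum] at h
    refine (measureReal_mono fun x hx => ?_).trans h
    simp only [Set.mem_ofPred_eq, mul_assoc, ← Finset.mul_sum] at hx ⊢
    gcongr
  have hsub : {x : Fin p → ℝ | a < |∑ k, d k * (x k ^ 2 - 1)|} ⊆
      {x | a ≤ ∑ k, d k * (x k ^ 2 - 1)} ∪ {x | a ≤ ∑ k, (-d k) * (x k ^ 2 - 1)} := by
    intro x hx
    simp only [Set.mem_ofPred_eq, Set.mem_union, neg_mul, Finset.sum_neg_distrib] at hx ⊢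
    rcases lt_abs.1 hx with h | h
    · exact Or.inl h.le
    · exact Or.inr h.le
  refine (measure_mono hsub).trans ((measure_union_le _ _).trans ?_)
  rw [two_mul, ENNReal.ofReal_add (Real.exp_pos _).le (Real.exp_pos _).le]
  refine add_le_add (measure_le_ofReal_of_measureReal_le (key d hd))
    (measure_le_ofReal_of_measureReal_le ?_)
  refine (key (fun k => -d k) fun k => by rw [mul_neg, abs_neg]; exact hd k).trans_eq ?_
  simp only [mul_neg, neg_sq]

lemma noiseLaw_lt_abs_centeredGram_le (hp : 0 < p) (hnp : n ≤ p) (hn : 0 < n)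
    {B : Matrix (Fin p) (Fin p) ℝ} {b : ℝ}
    (hb : 0 < b) (hB : ∀ v, l2 (Bᵀ *ᵥ v) ≤ b * l2 v) (q : ℝ) (y : Fin n → ℝ) :
    noiseLaw n p {Z | 4 * b ^ 2 * √(n * p) * q * (y ⬝ᵥ y) <
        |y ⬝ᵥ centeredGram (B * Bᵀ).trace (Matrix.of Z * B) *ᵥ y|} ≤
      ENNReal.ofReal (2 * Real.exp (n / 4 - n * q)) := by
  have hp' : (0 : ℝ) < p := by exact_mod_cast hp
  have hn' : (0 : ℝ) < n := by exact_mod_cast hn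
  rcases (l2_nonneg y).eq_or_lt with h0 | h0
  · have : y = 0 := dotProduct_self_eq_zero.1 (by rw [← l2_sq, ← h0]; simp)
    subst this; simp
  set x := (l2 y)⁻¹ • y with hx
  have hyx : y = l2 y • x := by rw [hx, smul_smul, mul_inv_cancel₀ h0.ne', one_smul]
  have hx1 : x ⬝ᵥ x = 1 := by
    rw [hx, smul_dotProduct, dotProduct_smul, ← l2_sq]
    simp only [smul_eq_mul]; field_simp
  have hA : (B * Bᵀ).IsHermitian := by
    rw [IsHermitian, conjTranspose_eq_transpose_of_trivial, transpose_mul, transpose_transpose]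
  set d := hA.eigenvalues
  set u : Fin p → Fin p → ℝ := fun k => (hA.eigenvectorBasis k).ofLp
  have hquad : ∀ v : Fin p → ℝ, v ⬝ᵥ (B * Bᵀ) *ᵥ v = l2 (Bᵀ *ᵥ v) ^ 2 := by
    intro v
    rw [l2_sq, ← mulVec_mulVec, dotProduct_mulVec, ← mulVec_transpose]
  have hin : ∀ u v : EuclideanSpace ℝ (Fin p), inner ℝ u v = u.ofLp ⬝ᵥ v.ofLp := fun u v => by
    simp [PiLp.inner_apply, dotProduct, mul_comm]
  have huu : ∀ k, u k ⬝ᵥ u k = 1 := fun k => by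
    have := hA.eigenvectorBasis.orthonormal.1 k
    rw [← hin, real_inner_self_eq_norm_sq, this]; norm_num
  have hd : ∀ k, 0 ≤ d k ∧ d k ≤ b ^ 2 := by
    intro k
    have h1 : d k = l2 (Bᵀ *ᵥ u k) ^ 2 := by
      rw [← hquad, hA.mulVec_eigenvectorBasis, dotProduct_smul, huu]; simp [d]
    have h2 : l2 (u k) = 1 := by
      have := l2_sq (u k)
      rw [huu] at this
      nlinarith [l2_nonneg (u k)]
    rw [h1]
    refine ⟨sq_nonneg _, pow_le_pow_left₀ (l2_nonneg _) ?_ 2⟩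
    have := hB (u k)
    rwa [h2, mul_one] at this
  have hu : ∀ t : Fin p → ℝ, (∑ k, t k • u k) ⬝ᵥ (∑ k, t k • u k) = t ⬝ᵥ t := by
    intro t
    have h := hA.eigenvectorBasis.orthonormal.inner_sum t t Finset.univ
    simp only [hin, WithLp.ofLp_sum, WithLp.ofLp_smul, conj_trivial] at h
    exact h
  have hT : (B * Bᵀ).trace = ∑ k, d k := by
    have := hA.trace_eq_sum_eigenvalues
    simpa using this
  have hform : ∀ Z : Fin n → Fin p → ℝ,
      y ⬝ᵥ centeredGram (B * Bᵀ).trace (Matrix.of Z * B) *ᵥ y =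
        (y ⬝ᵥ y) * ∑ k, d k * ((x ⬝ᵥ (Matrix.of Z *ᵥ u k)) ^ 2 - 1) := by
    intro Z
    have h1 : x ⬝ᵥ centeredGram (B * Bᵀ).trace (Matrix.of Z * B) *ᵥ x =
        ∑ k, d k * ((x ⬝ᵥ (Matrix.of Z *ᵥ u k)) ^ 2 - 1) := by
      rw [centeredGram_mulVec, dotProduct_sub, dotProduct_smul, hx1, hT]
      have h2 : x ⬝ᵥ (Matrix.of Z * B) *ᵥ ((Matrix.of Z * B)ᵀ *ᵥ x)
          = ((Matrix.of Z)ᵀ *ᵥ x) ⬝ᵥ (B * Bᵀ) *ᵥ ((Matrix.of Z)ᵀ *ᵥ x) := by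
        rw [hquad, l2_sq, dotProduct_mulVec, ← mulVec_transpose, mulVec_mulVec, ← transpose_mul]
      rw [h2, (sum_eigenvalues_mul_dotProduct_sq hA _).1]
      have h3 : ∀ k, (hA.eigenvectorBasis k).ofLp ⬝ᵥ (Matrix.of Z)ᵀ *ᵥ x
          = x ⬝ᵥ (Matrix.of Z *ᵥ u k) := by
        intro k
        rw [dotProduct_mulVec, vecMul_transpose, dotProduct_comm]
      simp only [h3, mul_sub, Finset.sum_sub_distrib, mul_one, smul_eq_mul]
      rfl
    rw [← h1, ← l2_sq]
    conv_lhs => rw [hyx]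
    rw [mulVec_smul, smul_dotProduct, dotProduct_smul, smul_eq_mul, smul_eq_mul]
    ring
  have hy : 0 < y ⬝ᵥ y := by rw [← l2_sq]; positivity
  set a := 4 * b ^ 2 * √(n * p) * q with ha
  have hmeas : Measurable (fun (Z : Fin n → Fin p → ℝ) k => x ⬝ᵥ (Matrix.of Z *ᵥ u k)) := by
    simp only [dotProduct, mulVec, of_apply]
    fun_prop
  have hset : {Z : Fin n → Fin p → ℝ | a * (y ⬝ᵥ y) <
        |y ⬝ᵥ centeredGram (B * Bᵀ).trace (Matrix.of Z * B) *ᵥ y|} =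
      (fun (Z : Fin n → Fin p → ℝ) k => x ⬝ᵥ (Matrix.of Z *ᵥ u k)) ⁻¹'
        {g | a < |∑ k, d k * (g k ^ 2 - 1)|} := by
    ext Z
    simp only [Set.mem_ofPred_eq, Set.mem_preimage]
    rw [hform, abs_mul, abs_of_pos hy, mul_comm, mul_lt_mul_iff_right₀ hy]
  rw [hset, ← Measure.map_apply hmeas (measurableSet_lt (by fun_prop) (by fun_prop)),
    noiseLaw_map_eq_gaussPi hx1 hu]
  set r := √(n / p) / (4 * b ^ 2) with hr
  have hr0 : 0 < r := by positivity
  have hsq1 : √((n : ℝ) / p) ≤ 1 := by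
    rw [Real.sqrt_le_one, div_le_one hp']
    exact_mod_cast hnp
  have hrd : ∀ k, 0 ≤ r * d k ∧ r * d k ≤ √(n / p) / 4 := by
    intro k
    refine ⟨mul_nonneg hr0.le (hd k).1, ?_⟩
    calc r * d k ≤ r * b ^ 2 := by gcongr; exact (hd k).2
      _ = _ := by rw [hr]; field_simp
  refine (gaussPi_lt_abs_sum_mul_sq_sub_one_le d (r := r) (fun k => ?_) hr0).trans ?_
  · rw [abs_of_nonneg (hrd k).1]
    linarith [(hrd k).2]
  · refine ENNReal.ofReal_le_ofReal ?_
    have h1 : ∑ k, (r * d k) ^ 2 ≤ n / 16 := by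
      calc ∑ k, (r * d k) ^ 2 ≤ ∑ _k : Fin p, (√((n : ℝ) / p) / 4) ^ 2 :=
            Finset.sum_le_sum fun k _ => pow_le_pow_left₀ (hrd k).1 (hrd k).2 2
        _ = n / 16 := by
            rw [Finset.sum_const, div_pow, Real.sq_sqrt (by positivity)]
            simp only [Finset.card_univ, Fintype.card_fin, nsmul_eq_mul]
            field_simp; norm_num
    have h2 : r * a = n * q := by
      have : √((n : ℝ) / p) * √(n * p) = n := by
        rw [← Real.sqrt_mul (by positivity)]
        rw [show (n : ℝ) / p * (n * p) = n ^ 2 by field_simp]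
        exact Real.sqrt_sq hn'.le
      calc r * a = (√((n : ℝ) / p) * √(n * p)) * q := by rw [hr, ha]; field_simp
        _ = _ := by rw [this]
    rw [h2]
    gcongr
    linarith

lemma noiseLaw_not_forall_abs_centeredGram_le (hp : 0 < p) (hnp : n ≤ p) (hn : 0 < n)
    {B : Matrix (Fin p) (Fin p) ℝ} {b : ℝ}
    (hb : 0 < b) (hB : ∀ v, l2 (Bᵀ *ᵥ v) ≤ b * l2 v) {q : ℝ} (hq : 0 ≤ q) :
    noiseLaw n p {Z | ¬ ∀ y : Fin n → ℝ,
        |y ⬝ᵥ centeredGram (B * Bᵀ).trace (Matrix.of Z * B) *ᵥ y| ≤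
          8 * b ^ 2 * √(n * p) * q * (y ⬝ᵥ y)} ≤
      ENNReal.ofReal ((16 * n + 1) ^ n * (2 * Real.exp (n / 4 - n * q))) := by
  have hsub : {Z : Fin n → Fin p → ℝ | ¬ ∀ y : Fin n → ℝ,
        |y ⬝ᵥ centeredGram (B * Bᵀ).trace (Matrix.of Z * B) *ᵥ y| ≤
          8 * b ^ 2 * √(n * p) * q * (y ⬝ᵥ y)} ⊆
      ⋃ f : Fin n → Fin (16 * n + 1), {Z | 4 * b ^ 2 * √(n * p) * q *
        (gridPoint f ⬝ᵥ gridPoint f) <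
        |gridPoint f ⬝ᵥ centeredGram (B * Bᵀ).trace (Matrix.of Z * B) *ᵥ gridPoint f|} := by
    intro Z hZ
    by_contra hcon
    simp only [Set.mem_iUnion, Set.mem_ofPred_eq, not_exists, not_lt] at hcon
    refine hZ fun y => ?_
    have := abs_quadratic_le_of_gridPoint hn (centeredGram_isSymm _ _) (by positivity) hcon y
    linarith
  refine (measure_mono hsub).trans ((measure_iUnion_fintype_le _ _).trans ?_)
  refine (Finset.sum_le_sum fun f _ =>
    noiseLaw_lt_abs_centeredGram_le hp hnp hn hb hB q (gridPoint f)).trans ?_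
  rw [Finset.sum_const, Finset.card_univ, Fintype.card_fun, Fintype.card_fin, Fintype.card_fin,
    nsmul_eq_mul, ← ENNReal.ofReal_natCast, ← ENNReal.ofReal_mul (by positivity)]
  push_cast
  rfl

end HansonWright

section JointLaw
open Matrix

variable {n p : ℕ}

lemma isProbabilityMeasure_jointLaw {ε τ : ℝ} (h0 : 0 ≤ ε) (h1 : ε ≤ 1) :
    IsProbabilityMeasure (jointLaw n p ε τ) := by
  have := isProbabilityMeasure_muLaw (τ := τ) h0 h1
  unfold jointLaw; infer_instance

lemma noiseLaw_lt_abs_dotProduct_le {g : (Fin n → Fin p → ℝ) → Fin p → ℝ} (i : Fin n)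
    (hg : Measurable g) (hgi : ∀ Z v, g (Function.update Z i v) = g Z) {t : ℝ} (ht : 0 ≤ t) :
    noiseLaw n p {Z | t * l2 (g Z) < |Z i ⬝ᵥ g Z|} ≤
      ENNReal.ofReal (2 * Real.exp (-t ^ 2 / 2)) := by
  set S : Set (Fin n → Fin p → ℝ) := {Z | t * l2 (g Z) < |Z i ⬝ᵥ g Z|}
  set c := ENNReal.ofReal (2 * Real.exp (-t ^ 2 / 2))
  have hS : MeasurableSet S := by
    refine measurableSet_lt ?_ ?_
    · simp only [l2]; fun_prop
    · simp only [dotProduct]; fun_prop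
  have hf : Measurable (S.indicator (1 : (Fin n → Fin p → ℝ) → ℝ≥0∞)) :=
    measurable_one.indicator hS
  have hconst : ∀ x,
      (∫⋯∫⁻_(Finset.univ.erase i), (fun _ => c) ∂(fun _ : Fin n => gaussPi p)) x = c := by
    intro x
    have h1 := congrFun (lmarginal_erase' (μ := fun _ : Fin n => gaussPi p) (fun _ => c)
      measurable_const (Finset.mem_univ i)) x
    simp only [lmarginal_univ, lintegral_const, measure_univ, mul_one] at h1
    exact h1.symm
  rw [← lintegral_indicator_one hS, noiseLaw, lintegral_eq_lmarginal_univ 0,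
    lmarginal_erase' _ hf (Finset.mem_univ i)]
  refine le_trans ?_ (hconst 0).le
  refine lmarginal_mono (fun Z => ?_) 0
  have hpre : ∀ v, S.indicator (1 : (Fin n → Fin p → ℝ) → ℝ≥0∞) (Function.update Z i v) =
      {v : Fin p → ℝ | t * l2 (g Z) < |v ⬝ᵥ g Z|}.indicator 1 v := by
    intro v
    simp [S, Set.indicator_apply, hgi]
  simp only [hpre]
  rw [lintegral_indicator_one (measurableSet_lt (by fun_prop)
    (by simp only [dotProduct]; fun_prop))]
  exact gaussPi_lt_abs_dotProduct_le _ ht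

lemma jointLaw_le_of_forall_noiseLaw_le {ε τ : ℝ} (h0 : 0 ≤ ε) (h1 : ε ≤ 1)
    {A : Set (Omega n p)} (hA : MeasurableSet A) {c : ℝ≥0∞}
    (h : ∀ ℓ μ, noiseLaw n p {Z | (ℓ, μ, Z) ∈ A} ≤ c) : jointLaw n p ε τ A ≤ c := by
  have := isProbabilityMeasure_muLaw (τ := τ) h0 h1
  rw [jointLaw, Measure.prod_apply hA]
  calc _ ≤ ∫⁻ _ : Fin n → ℝ, c ∂(Measure.pi fun _ : Fin n => signLaw) := by
        refine lintegral_mono fun ℓ => ?_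
        rw [Measure.prod_apply (measurable_prodMk_left hA)]
        calc _ ≤ ∫⁻ _ : Fin p → ℝ, c ∂(Measure.pi fun _ : Fin p => muLaw ε τ) :=
              lintegral_mono fun μ => h ℓ μ
          _ = c := by simp
    _ = c := by simp

lemma jointLaw_noise_eq {ε τ : ℝ} (h0 : 0 ≤ ε) (h1 : ε ≤ 1) (S : Set (Fin n → Fin p → ℝ)) :
    jointLaw n p ε τ {ω | ω.2.2 ∈ S} = noiseLaw n p S := by
  have := isProbabilityMeasure_muLaw (τ := τ) h0 h1
  have : {ω : Omega n p | ω.2.2 ∈ S} = Set.univ ×ˢ (Set.univ ×ˢ S) := by ext; simp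
  rw [this, jointLaw, Measure.prod_prod, Measure.prod_prod]
  simp

lemma jointLaw_signal_eq {ε τ : ℝ} (h0 : 0 ≤ ε) (h1 : ε ≤ 1) (S : Set (Fin p → ℝ)) :
    jointLaw n p ε τ {ω | ω.2.1 ∈ S} = (Measure.pi fun _ : Fin p => muLaw ε τ) S := by
  have := isProbabilityMeasure_muLaw (τ := τ) h0 h1
  have : {ω : Omega n p | ω.2.1 ∈ S} = Set.univ ×ˢ (S ×ˢ Set.univ) := by ext; simp
  rw [this, jointLaw, Measure.prod_prod, Measure.prod_prod]
  simp

lemma jointLaw_not_forall_label_sq_eq_one {ε τ : ℝ} (h0 : 0 ≤ ε) (h1 : ε ≤ 1) :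
    jointLaw n p ε τ {ω | ¬ ∀ i, ω.1 i ^ 2 = 1} = 0 := by
  have := isProbabilityMeasure_muLaw (τ := τ) h0 h1
  have hsub : {ω : Omega n p | ¬ ∀ i, ω.1 i ^ 2 = 1} =
    {ℓ : Fin n → ℝ | ¬ ∀ i, ℓ i ^ 2 = 1} ×ˢ Set.univ := by ext; simp
  rw [hsub, jointLaw, Measure.prod_prod, measure_univ, mul_one]
  have hs : ∀ᵐ x ∂signLaw, x ^ 2 = (1 : ℝ) := by
    have : MeasurableSet {x : ℝ | x ^ 2 = 1} := measurableSet_eq_fun (by fun_prop) (by fun_prop)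
    rw [ae_iff, signLaw]
    have h2 : MeasurableSet {x : ℝ | ¬ x ^ 2 = 1} := this.compl
    rw [Measure.add_apply, Measure.smul_apply, Measure.smul_apply, Measure.dirac_apply' _ h2,
      Measure.dirac_apply' _ h2]
    simp
  rw [← ae_iff]
  exact ae_all_iff.2 fun i =>
    (Measure.tendsto_eval_ae_ae (μ := fun _ : Fin n => signLaw)).eventually hs

lemma jointLaw_signal_lt_le {ε τ : ℝ} (h0 : 0 ≤ ε) (h1 : ε ≤ 1) (hτ : 0 < τ) :
    jointLaw n p ε τ {ω | ω.2.1 ⬝ᵥ ω.2.1 < p * ε * τ ^ 2 / 2} ≤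
      ENNReal.ofReal (Real.exp (-(p * ε) / 10)) := by
  have := isProbabilityMeasure_muLaw (τ := τ) h0 h1
  refine (jointLaw_signal_eq (n := n) h0 h1 {μ | μ ⬝ᵥ μ < p * ε * τ ^ 2 / 2}).trans_le ?_
  have h_int : ∀ f : ℝ → ℝ, Measurable f → Integrable f (muLaw ε τ) ∧
      ∫ x, f x ∂(muLaw ε τ) = (1 - ε) * f 0 + ε * f τ := by
    intro f hf
    have ha : ∀ x, Integrable f (Measure.dirac x) := fun x => by
      apply integrable_dirac; simp
    have hI1 : Integrable f (ENNReal.ofReal (1 - ε) • Measure.dirac (0 : ℝ)) :=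
      (ha 0).smul_measure ENNReal.ofReal_ne_top
    have hI2 : Integrable f (ENNReal.ofReal ε • Measure.dirac τ) :=
      (ha τ).smul_measure ENNReal.ofReal_ne_top
    refine ⟨hI1.add_measure hI2, ?_⟩
    rw [muLaw, integral_add_measure hI1 hI2, integral_smul_measure, integral_smul_measure,
      integral_dirac, integral_dirac, ENNReal.toReal_ofReal (by linarith), ENNReal.toReal_ofReal h0]
    simp
  have hE := fun (j : Fin p) => h_int (fun x => Real.exp (-(x ^ 2 / τ ^ 2))) (by fun_prop)
  have h := measureReal_pi_le_sum_le (μ := fun _ : Fin p => muLaw ε τ)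
    (fun _ x => -(x ^ 2 / τ ^ 2)) (fun _ => -(ε * (1 - Real.exp (-1)))) (-(p * ε / 2))
    (fun j => (hE j).1) (fun j => by
      rw [(hE j).2]
      have := Real.add_one_le_exp (-(ε * (1 - Real.exp (-1))))
      rw [div_self (by positivity)]
      simp only [ne_eq, OfNat.ofNat_ne_zero, not_false_eq_true, zero_pow, zero_div, neg_zero,
        Real.exp_zero, mul_one]
      linarith)
  refine measure_le_ofReal_of_measureReal_le ((measureReal_mono fun x hx => ?_).trans
    (h.trans (Real.exp_le_exp.2 ?_)))
  · simp only [Set.mem_ofPred_eq, dotProduct_self_eq, Finset.sum_neg_distrib,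
      ← Finset.sum_div] at hx ⊢
    rw [neg_le_neg_iff, div_le_iff₀ (by positivity)]
    linarith
  · have he : Real.exp (-1) ≤ 0.4 := by
      rw [Real.exp_neg, inv_le_comm₀ (Real.exp_pos _) (by norm_num)]
      linarith [Real.exp_one_gt_d9]
    simp only [Finset.sum_const, Finset.card_univ, Fintype.card_fin, nsmul_eq_mul]
    have hpe : 0 ≤ p * ε := by positivity
    nlinarith

end JointLaw

section Recovery
open Matrix

variable {n p : ℕ}

/-- The vector against which a row of the noise is tested, given the remaining rows. -/
noncomputable def leaveOneOut (B : Matrix (Fin p) (Fin p) ℝ) (T : ℝ) (k : ℕ)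
    (R : Matrix (Fin n) (Fin p) ℝ) (v : Fin n → ℝ) : Fin p → ℝ :=
  B *ᵥ (Rᵀ *ᵥ (centeredGram T R ^ k *ᵥ v))

lemma continuous_leaveOneOut {X : Type*} [TopologicalSpace X] (B : Matrix (Fin p) (Fin p) ℝ)
    (T : ℝ) (k : ℕ) {R : X → Matrix (Fin n) (Fin p) ℝ} {v : X → Fin n → ℝ} (hR : Continuous R)
    (hv : Continuous v) : Continuous fun x => leaveOneOut B T k (R x) (v x) := by
  have hE : Continuous fun x => centeredGram T (R x) := by unfold centeredGram; fun_prop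
  unfold leaveOneOut
  fun_prop

lemma continuous_eraseRow (i : Fin n) (B : Matrix (Fin p) (Fin p) ℝ) :
    Continuous fun Z : Fin n → Fin p → ℝ => eraseRow i (Matrix.of Z * B) := by
  unfold eraseRow
  have h : Continuous fun Z : Fin n → Fin p → ℝ => (Matrix.of Z : Matrix (Fin n) (Fin p) ℝ) :=
    continuous_id
  have h2 : Continuous fun Z : Fin n → Fin p → ℝ => Matrix.of Z * B := h.matrix_mul continuous_const
  exact h2.matrix_updateRow i continuous_const

lemma eraseRow_update_mul (i : Fin n) (B : Matrix (Fin p) (Fin p) ℝ) (Z : Fin n → Fin p → ℝ)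
    (v : Fin p → ℝ) :
    eraseRow i (Matrix.of (Function.update Z i v) * B) = eraseRow i (Matrix.of Z * B) := by
  ext j k
  by_cases h : j = i
  · subst h; simp [eraseRow]
  · simp [eraseRow, mul_apply, h]

lemma centeredGram_eraseRow_pow_mulVec_apply {B : Matrix (Fin p) (Fin p) ℝ} {T s : ℝ} (i : Fin n)
    {Z : Fin n → Fin p → ℝ} (hs : 0 ≤ s)
    (h : ∀ x, l2 (centeredGram T (Matrix.of Z * B) *ᵥ x) ≤ s * l2 x) {u : Fin n → ℝ}
    (hu : u i = 0) (k : ℕ) :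
    (centeredGram T (Matrix.of Z * B) *ᵥ
      (centeredGram T (eraseRow i (Matrix.of Z * B)) ^ k *ᵥ u)) i =
      Z i ⬝ᵥ leaveOneOut B T k (eraseRow i (Matrix.of Z * B)) u := by
  have h0 := (centeredGram_eraseRow_pow_mulVec i hs h hu k).1
  rw [leaveOneOut, transpose_eraseRow_mulVec i _ h0, centeredGram_mulVec, Pi.sub_apply,
    Pi.smul_apply, h0, smul_zero, sub_zero, ← mulVec_mulVec]
  rfl

lemma l2_leaveOneOut_le {B : Matrix (Fin p) (Fin p) ℝ} {T s b : ℝ} (i : Fin n)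
    {Z : Fin n → Fin p → ℝ} (hs : 0 < s) (hb : 0 ≤ b) (hB : ∀ v, l2 (B *ᵥ v) ≤ b * l2 v)
    (h : ∀ x, |x ⬝ᵥ centeredGram T (Matrix.of Z * B) *ᵥ x| ≤ s * (x ⬝ᵥ x)) {u : Fin n → ℝ}
    (hu : u i = 0) (k : ℕ) :
    l2 (leaveOneOut B T k (eraseRow i (Matrix.of Z * B)) u) ≤
      b * √(s + T) * (s ^ k * l2 u) := by
  obtain ⟨h0, h1⟩ := centeredGram_eraseRow_pow_mulVec i hs.le
    (l2_mulVec_le_of_quadratic (centeredGram_isSymm T _) hs h) hu k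
  rw [leaveOneOut, transpose_eraseRow_mulVec i _ h0, mul_assoc]
  refine (hB _).trans (mul_le_mul_of_nonneg_left ((l2_transpose_mulVec_le h _).trans ?_) hb)
  exact mul_le_mul_of_nonneg_left h1 (Real.sqrt_nonneg _)

lemma jointLaw_lt_abs_dotProduct_le {ε τ t : ℝ} (h0 : 0 ≤ ε) (h1 : ε ≤ 1) (ht : 0 ≤ t) (i : Fin n)
    {g : Omega n p → Fin p → ℝ} (hg : Continuous g)
    (hgi : ∀ ℓ μ Z v, g (ℓ, μ, Function.update Z i v) = g (ℓ, μ, Z)) :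
    jointLaw n p ε τ {ω | t * l2 (g ω) < |ω.2.2 i ⬝ᵥ g ω|} ≤
      ENNReal.ofReal (2 * Real.exp (-t ^ 2 / 2)) := by
  have hgm := hg.measurable
  refine jointLaw_le_of_forall_noiseLaw_le h0 h1 ?_ fun ℓ μ => ?_
  · refine measurableSet_lt ?_ ?_
    · simp only [l2]; fun_prop
    · simp only [dotProduct]; fun_prop
  · exact noiseLaw_lt_abs_dotProduct_le i (g := fun Z => g (ℓ, μ, Z)) (by fun_prop)
      (fun Z v => hgi ℓ μ Z v) ht

lemma trace_mul_transpose_le {B : Matrix (Fin p) (Fin p) ℝ} {b : ℝ}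
    (hB : ∀ v, l2 (Bᵀ *ᵥ v) ≤ b * l2 v) : (B * Bᵀ).trace ≤ p * b ^ 2 := by
  have : ∀ j, (B * Bᵀ) j j ≤ b ^ 2 := by
    intro j
    have h1 := hB (Pi.single j 1)
    have h2 : l2 (Pi.single j 1 : Fin p → ℝ) = 1 := by
      have := l2_sq (Pi.single j 1 : Fin p → ℝ)
      simp at this
      exact this.resolve_right (by linarith [l2_nonneg (Pi.single j 1 : Fin p → ℝ)])
    have h3 : (B * Bᵀ) j j = l2 (Bᵀ *ᵥ Pi.single j 1) ^ 2 := by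
      rw [l2_sq, dotProduct_mulVec, ← mulVec_transpose, transpose_transpose, mulVec_mulVec]
      simp
    rw [h2, mul_one] at h1
    rw [h3]
    exact pow_le_pow_left₀ (l2_nonneg _) h1 2
  calc (B * Bᵀ).trace = ∑ j, (B * Bᵀ) j j := rfl
    _ ≤ ∑ _j : Fin p, b ^ 2 := Finset.sum_le_sum fun j _ => this j
    _ = p * b ^ 2 := by simp

lemma jointLaw_not_recovery_le {ε τ t q b κ : ℝ} {K : ℕ} (hn : 0 < n) (hnp : n ≤ p)
    (h0 : 0 < ε) (h1 : ε ≤ 1) (hτ : 0 < τ) (ht : 0 ≤ t) (hq : 0 < q) (hb : 0 < b)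
    (hκ0 : 0 < κ) (hκ : κ ≤ 1 / 1000)
    {B : Matrix (Fin p) (Fin p) ℝ} (hB : ∀ v, l2 (B *ᵥ v) ≤ b * l2 v)
    (hBt : ∀ v, l2 (Bᵀ *ᵥ v) ≤ b * l2 v)
    (hs : 8 * b ^ 2 * √(n * p) * q ≤ κ * (n * (p * ε * τ ^ 2 / 2)))
    (hD : t * b * √(8 * b ^ 2 * √(n * p) * q + p * b ^ 2) * √n ≤ κ * (n * (p * ε * τ ^ 2 / 2)))
    (hw : t * b ≤ κ * √(p * ε * τ ^ 2 / 2)) (hK : √n * (2 * κ) ^ K ≤ 1)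
    {ξ : Omega n p → Fin n → ℝ} (hξ : ∀ ω, IsTopEigenvector (gram (dataColoredB B ω)) (ξ ω)) :
    jointLaw n p ε τ {ω | ¬ ((∀ i, |√n * ξ ω i - ω.1 i| ≤ 100 * κ) ∨
        ∀ i, |√n * ξ ω i + ω.1 i| ≤ 100 * κ)} ≤
      ENNReal.ofReal (Real.exp (-(p * ε) / 10)
        + (16 * n + 1) ^ n * (2 * Real.exp (n / 4 - n * q))
        + n * (2 * K + 1) * (2 * Real.exp (-t ^ 2 / 2))) := by
  have hp : 0 < p := hn.trans_le hnp
  have hn' : (0 : ℝ) < n := by exact_mod_cast hn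
  have hp' : (0 : ℝ) < p := by exact_mod_cast hp
  set T := (B * Bᵀ).trace with hT
  have hTle : T ≤ p * b ^ 2 := trace_mul_transpose_le hBt
  set s := 8 * b ^ 2 * √(n * p) * q with hs_def
  have hs0 : 0 < s := by positivity
  set m₀ := p * ε * τ ^ 2 / 2 with hm₀
  have hm₀pos : 0 < m₀ := by positivity
  set D := t * b * √(s + p * b ^ 2) * √n with hD_def
  have hD0 : 0 ≤ D := by positivity
  set c := ENNReal.ofReal (2 * Real.exp (-t ^ 2 / 2)) with hc
  let R : Fin n → Omega n p → Matrix (Fin n) (Fin p) ℝ := fun i ω =>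
    eraseRow i (Matrix.of ω.2.2 * B)
  have hRc : ∀ i, Continuous (R i) := fun i => (continuous_eraseRow i B).comp (by fun_prop)
  have hRi : ∀ i ℓ μ Z v, R i (ℓ, μ, Function.update Z i v) = R i (ℓ, μ, Z) := fun i ℓ μ Z v =>
    eraseRow_update_mul i B Z v
  let gℓ : Fin n → ℕ → Omega n p → Fin p → ℝ := fun i k ω =>
    leaveOneOut B T k (R i ω) (Function.update ω.1 i 0)
  let gw : Fin n → ℕ → Omega n p → Fin p → ℝ := fun i k ω =>
    leaveOneOut B T k (R i ω) (R i ω *ᵥ ω.2.1)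
  let bad : (Omega n p → Fin p → ℝ) → Fin n → Set (Omega n p) := fun g i =>
    {ω | t * l2 (g ω) < |ω.2.2 i ⬝ᵥ g ω|}
  have hbadℓ : ∀ i k, jointLaw n p ε τ (bad (gℓ i k) i) ≤ c := fun i k =>
    jointLaw_lt_abs_dotProduct_le h0.le h1 ht i
      (continuous_leaveOneOut B T k (hRc i) (by fun_prop)) (fun ℓ μ Z v => by simp only [gℓ, hRi])
  have hbadw : ∀ i k, jointLaw n p ε τ (bad (gw i k) i) ≤ c := fun i k =>
    jointLaw_lt_abs_dotProduct_le h0.le h1 ht i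
      (continuous_leaveOneOut B T k (hRc i) ((hRc i).matrix_mulVec (by fun_prop)))
      (fun ℓ μ Z v => by simp only [gw, hRi])
  have hbadμ : ∀ i, jointLaw n p ε τ (bad (fun ω => B *ᵥ ω.2.1) i) ≤ c := fun i =>
    jointLaw_lt_abs_dotProduct_le h0.le h1 ht i (by fun_prop) (fun ℓ μ Z v => rfl)
  have hsub : {ω | ¬ ((∀ i, |√n * ξ ω i - ω.1 i| ≤ 100 * κ) ∨
        ∀ i, |√n * ξ ω i + ω.1 i| ≤ 100 * κ)} ⊆
      {ω | ¬ ∀ i, ω.1 i ^ 2 = 1} ∪ {ω | ω.2.1 ⬝ᵥ ω.2.1 < m₀} ∪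
      {ω | ω.2.2 ∈ {Z | ¬ ∀ y : Fin n → ℝ,
        |y ⬝ᵥ centeredGram T (Matrix.of Z * B) *ᵥ y| ≤ s * (y ⬝ᵥ y)}} ∪
      ⋃ i : Fin n, (bad (fun ω => B *ᵥ ω.2.1) i ∪
        ⋃ k : Fin K, (bad (gℓ i k) i ∪ bad (gw i k) i)) := by
    intro ω hω
    by_contra hcon
    simp only [Set.mem_union, Set.mem_ofPred_eq, Set.mem_iUnion, not_or, not_not, not_exists,
      not_lt, bad] at hcon
    obtain ⟨⟨⟨hsign, hm⟩, hE⟩, hrow⟩ := hcon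
    refine hω ?_
    obtain ⟨hξ1, z, heq, hz⟩ := (hξ ω).exists_shifted_eigenvalue T
    set Y := Matrix.of ω.2.2 * B with hY
    set m := ω.2.1 ⬝ᵥ ω.2.1 with hm_def
    have hmpos : 0 < m := hm₀pos.trans_le hm
    have hle : ∀ x : ℝ, x ≤ κ * (n * m₀) → x ≤ κ * (n * m) := fun x hx => hx.trans (by gcongr)
    have hℓℓ : ω.1 ⬝ᵥ ω.1 = n := by rw [dotProduct_self_eq]; simp [hsign]
    rw [hℓℓ] at hz
    have hop := l2_mulVec_le_of_quadratic (centeredGram_isSymm T Y) hs0 hE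
    have hm_sq : l2 ω.2.1 = √m := by rw [l2, ← dotProduct_self_eq]
    have hwi : ∀ i, |(Y *ᵥ ω.2.1) i| ≤ κ * m := by
      intro i
      have hYw : (Y *ᵥ ω.2.1) i = ω.2.2 i ⬝ᵥ B *ᵥ ω.2.1 := by
        rw [hY, ← mulVec_mulVec]; rfl
      rw [hYw]
      calc _ ≤ t * l2 (B *ᵥ ω.2.1) := (hrow i).1
        _ ≤ t * (b * √m) := by rw [← hm_sq]; gcongr; exact hB _
        _ = t * b * √m := by ring
        _ ≤ κ * √m * √m :=
          mul_le_mul_of_nonneg_right (hw.trans (by gcongr)) (Real.sqrt_nonneg _)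
        _ = κ * m := by rw [mul_assoc, Real.mul_self_sqrt hmpos.le]
    have hloo : ∀ i (k : ℕ) (u : Fin n → ℝ), u i = 0 →
        |ω.2.2 i ⬝ᵥ leaveOneOut B T k (R i ω) u| ≤ t * l2 (leaveOneOut B T k (R i ω) u) →
        |(centeredGram T Y *ᵥ (centeredGram T (eraseRow i Y) ^ k *ᵥ u)) i| ≤
          s ^ k * (t * b * √(s + p * b ^ 2) * l2 u) := by
      intro i k u hu h
      rw [centeredGram_eraseRow_pow_mulVec_apply i hs0.le hop hu k]
      calc _ ≤ t * (b * √(s + T) * (s ^ k * l2 u)) :=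
            h.trans (mul_le_mul_of_nonneg_left (l2_leaveOneOut_le i hs0 hb.le hB hE hu k) ht)
        _ ≤ t * (b * √(s + p * b ^ 2) * (s ^ k * l2 u)) := by
            have := l2_nonneg u
            gcongr
        _ = _ := by ring
    refine exists_sign_abs_sub_le (T := T) (s := s) (z := z) (m := m) (κ := κ) (D := D) (K := K) hn
      (Y := Y) (ℓ := ω.1) (w := Y *ᵥ ω.2.1) hsign hmpos hκ0 hκ hs0 (hle _ hs) hD0 (hle _ hD) hK hwi
      hE hξ1 heq hz ?_ ?_
    · intro i k hk
      refine (hloo i k _ (by simp) ((hrow i).2 ⟨k, hk⟩).1).trans ?_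
      have : l2 (Function.update ω.1 i 0) ≤ √n := by
        refine (l2_update_zero_le _ _).trans ?_
        rw [l2, ← dotProduct_self_eq, hℓℓ]
      rw [hD_def]
      gcongr
    · intro i k hk
      have hR : R i ω *ᵥ ω.2.1 = Function.update (Y *ᵥ ω.2.1) i 0 := eraseRow_mulVec i Y _
      have h := ((hrow i).2 ⟨k, hk⟩).2
      simp only [gw, hR] at h
      refine (hloo i k _ (by simp) h).trans ?_
      have : l2 (Function.update (Y *ᵥ ω.2.1) i 0) ≤ √n * (κ * m) :=
        (l2_update_zero_le _ _).trans (l2_le_of_abs_le hwi)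
      calc _ ≤ s ^ k * (t * b * √(s + p * b ^ 2) * (√n * (κ * m))) := by gcongr
        _ = _ := by rw [hD_def]; ring
  refine (measure_mono hsub).trans ?_
  refine (measure_union_le _ _).trans ?_
  rw [ENNReal.ofReal_add (by positivity) (by positivity),
    ENNReal.ofReal_add (by positivity) (by positivity)]
  refine add_le_add ((measure_union_le _ _).trans (add_le_add ((measure_union_le _ _).trans ?_) ?_))
    ?_
  · rw [jointLaw_not_forall_label_sq_eq_one h0.le h1, zero_add]
    exact jointLaw_signal_lt_le h0.le h1 hτ
  · rw [jointLaw_noise_eq h0.le h1]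
    exact noiseLaw_not_forall_abs_centeredGram_le hp hnp hn hb hBt hq.le
  · have hc2 : ENNReal.ofReal (n * (2 * K + 1) * (2 * Real.exp (-t ^ 2 / 2))) =
        n * ((2 * K + 1) * c) := by
      rw [ENNReal.ofReal_mul (by positivity), ENNReal.ofReal_mul (by positivity), ← hc,
        ENNReal.ofReal_add (by positivity) zero_le_one, ENNReal.ofReal_mul zero_le_two]
      simp [mul_assoc]
    rw [hc2]
    refine (measure_iUnion_fintype_le _ _).trans ?_
    calc _ ≤ ∑ _i : Fin n, (2 * K + 1) * c := by
          refine Finset.sum_le_sum fun i _ => (measure_union_le _ _).trans ?_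
          calc _ ≤ c + ∑ _k : Fin K, (c + c) := by
                refine add_le_add (hbadμ i) ((measure_iUnion_fintype_le _ _).trans ?_)
                exact Finset.sum_le_sum fun k _ => (measure_union_le _ _).trans
                  (add_le_add (hbadℓ i k) (hbadw i k))
            _ = _ := by
                simp only [Finset.sum_const, Finset.card_univ, Fintype.card_fin, nsmul_eq_mul]
                ring
      _ = _ := by simp

end Recovery

section Asymptotics
open Matrix

lemma failure_bound_le {p x y : ℝ} {n : ℕ} (K : ℕ) (hp : 100 ≤ p) (hn1 : 1 ≤ n) (hnp : (n : ℝ) ≤ p)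
    (hx : 2 ≤ x) (hxp : 30 * Real.log p ≤ x) (hyp : 30 * Real.log p ≤ y) :
    Real.exp (-y / 10) + (16 * n + 1) ^ n * (2 * Real.exp (n / 4 - n * x))
      + n * (2 * K + 1) * (2 * Real.exp (-x ^ 2 / 2)) ≤ (4 * K + 5) * p ^ (-(3 : ℝ)) := by
  have hp0 : 0 < p := by linarith
  have hlog : 0 ≤ Real.log p := Real.log_nonneg (by linarith)
  have hp3 : p ^ (-(3 : ℝ)) = Real.exp (-3 * Real.log p) := by
    rw [Real.rpow_def_of_pos hp0]; ring_nf
  have hexp : p = Real.exp (Real.log p) := (Real.exp_log hp0).symm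
  have h1 : Real.exp (-y / 10) ≤ p ^ (-(3 : ℝ)) := by
    rw [hp3]; exact Real.exp_le_exp.2 (by linarith)
  have h3 : n * (2 * K + 1) * (2 * Real.exp (-x ^ 2 / 2)) ≤ (4 * K + 2) * p ^ (-(3 : ℝ)) := by
    have he : Real.exp (-x ^ 2 / 2) ≤ Real.exp (-4 * Real.log p) :=
      Real.exp_le_exp.2 (by nlinarith)
    have : p * Real.exp (-4 * Real.log p) = p ^ (-(3 : ℝ)) := by
      rw [hp3]
      nth_rewrite 1 [hexp]
      rw [← Real.exp_add]; ring_nf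
    calc n * (2 * K + 1) * (2 * Real.exp (-x ^ 2 / 2))
        ≤ p * (2 * K + 1) * (2 * Real.exp (-4 * Real.log p)) := by gcongr
      _ = (4 * K + 2) * (p * Real.exp (-4 * Real.log p)) := by ring
      _ = _ := by rw [this]
  have h2 : (16 * n + 1) ^ n * (2 * Real.exp (n / 4 - n * x)) ≤ 2 * p ^ (-(3 : ℝ)) := by
    have hn1' : (1 : ℝ) ≤ n := by exact_mod_cast hn1
    have hq : Real.exp (n / 4 - n * x) = Real.exp (1 / 4 - x) ^ n := by
      rw [← Real.exp_nat_mul]; ring_nf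
    have h4 : Real.exp (1 / 4) ≤ 3 :=
      (Real.exp_le_exp.2 (by norm_num)).trans Real.exp_one_lt_three.le
    have hbase : (16 * n + 1) * Real.exp (1 / 4 - x) ≤ p ^ (-(3 : ℝ)) := by
      calc (16 * n + 1) * Real.exp (1 / 4 - x)
          = (16 * n + 1) * Real.exp (1 / 4) * Real.exp (-x) := by
            rw [mul_assoc, ← Real.exp_add, sub_eq_add_neg]
        _ ≤ (17 * p) * 3 * Real.exp (-5 * Real.log p) := by
            have h17 : 16 * n + 1 ≤ 17 * p := by linarith
            have hx5 : Real.exp (-x) ≤ Real.exp (-5 * Real.log p) :=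
              Real.exp_le_exp.2 (by linarith)
            gcongr
        _ ≤ p * p * Real.exp (-5 * Real.log p) :=
            mul_le_mul_of_nonneg_right (by nlinarith) (Real.exp_pos _).le
        _ = p ^ (-(3 : ℝ)) := by
            rw [hp3]
            nth_rewrite 1 2 [hexp]
            rw [← Real.exp_add, ← Real.exp_add]; ring_nf
    have hle1 : (16 * n + 1) * Real.exp (1 / 4 - x) ≤ 1 :=
      hbase.trans (Real.rpow_le_one_of_one_le_of_nonpos (by linarith) (by norm_num))
    calc (16 * n + 1) ^ n * (2 * Real.exp (n / 4 - n * x))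
        = 2 * ((16 * n + 1) * Real.exp (1 / 4 - x)) ^ n := by rw [hq, mul_pow]; ring
      _ ≤ 2 * ((16 * n + 1) * Real.exp (1 / 4 - x)) := by
          gcongr
          exact pow_le_of_le_one (by positivity) hle1 (by omega)
      _ ≤ _ := by gcongr
  linarith

lemma signal_dominates_noise {p n m x : ℝ} (hp : 0 < p) (hn : 0 < n) (hnp : n ≤ p) (hx : 16 ≤ x)
    (hm : x ^ 16 ≤ m) (hnm : x ^ 16 * √(n * p) ≤ n * m) :
    8 * x ^ 2 * √(n * p) * x ≤ (x ^ 4)⁻¹ * (n * (m / 2)) ∧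
    x * x * √(8 * x ^ 2 * √(n * p) * x + p * x ^ 2) * √n ≤ (x ^ 4)⁻¹ * (n * (m / 2)) ∧
    x * x ≤ (x ^ 4)⁻¹ * √(m / 2) := by
  have hx0 : 0 < x := by linarith
  have hr := Real.sqrt_nonneg (n * p)
  have h8 : (16 : ℝ) ^ 8 ≤ x ^ 8 := by gcongr
  have hmain : 8 * x ^ 4 * √(n * p) ≤ (x ^ 4)⁻¹ * (n * (m / 2)) := by
    rw [inv_mul_eq_div, le_div_iff₀ (by positivity)]
    have : 16 * x ^ 8 * √(n * p) ≤ x ^ 16 * √(n * p) := by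
      gcongr
      have : x ^ 16 = x ^ 8 * x ^ 8 := by ring
      rw [this]
      gcongr
      linarith
    linarith
  refine ⟨?_, ?_, ?_⟩
  · refine le_trans ?_ hmain
    have : x ^ 3 ≤ x ^ 4 := pow_le_pow_right₀ (by linarith) (by norm_num)
    calc 8 * x ^ 2 * √(n * p) * x = 8 * x ^ 3 * √(n * p) := by ring
      _ ≤ _ := by gcongr
  · refine le_trans ?_ hmain
    have hnp' : √(n * p) ≤ p := by
      rw [Real.sqrt_le_left hp.le]; nlinarith
    have h1 : √(8 * x ^ 2 * √(n * p) * x + p * x ^ 2) ≤ 3 * x ^ 2 * √p := by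
      rw [Real.sqrt_le_left (by positivity), mul_pow, Real.sq_sqrt hp.le]
      calc 8 * x ^ 2 * √(n * p) * x + p * x ^ 2 ≤ 8 * x ^ 2 * p * x + p * x ^ 2 := by gcongr
        _ = (8 * x ^ 3 + x ^ 2) * p := by ring
        _ ≤ (8 * x ^ 4 + x ^ 4) * p := by
          gcongr <;> linarith
        _ = _ := by ring
    calc x * x * √(8 * x ^ 2 * √(n * p) * x + p * x ^ 2) * √n
        ≤ x * x * (3 * x ^ 2 * √p) * √n := by gcongr
      _ = 3 * x ^ 4 * √(n * p) := by rw [Real.sqrt_mul hn.le]; ring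
      _ ≤ _ := by gcongr; norm_num
  · rw [inv_mul_eq_div, le_div_iff₀ (by positivity)]
    refine Real.le_sqrt_of_sq_le ?_
    calc (x * x * x ^ 4) ^ 2 = x ^ 12 := by ring
      _ ≤ x ^ 16 / 2 := by
        have h4 : (16 : ℝ) ^ 4 ≤ x ^ 4 := by gcongr
        have : x ^ 16 = x ^ 12 * x ^ 4 := by ring
        nlinarith [pow_pos hx0 12]
      _ ≤ m / 2 := by gcongr

lemma linf_le {n : ℕ} (hn : 0 < n) {v : Fin n → ℝ} {c : ℝ} (h : ∀ i, |v i| ≤ c) : linf v ≤ c :=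
  have : Nonempty (Fin n) := ⟨⟨0, hn⟩⟩
  ciSup_le h

/-- No measurability of the event is required. -/
lemma one_sub_le_toReal_of_not_le {Ω : Type*} [MeasurableSpace Ω] (P : Measure Ω)
    [IsProbabilityMeasure P] {good bad : Set Ω} (h : ∀ ω, ω ∉ bad → ω ∈ good) {c : ℝ} (hc : 0 ≤ c)
    (hbad : P bad ≤ ENNReal.ofReal c) : 1 - c ≤ (P good).toReal := by
  have h1 : (1 : ℝ≥0∞) ≤ P good + P bad := by
    rw [← measure_univ (μ := P)]
    refine (measure_mono fun ω _ => ?_).trans (measure_union_le good bad)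
    by_cases hω : ω ∈ bad
    · exact Or.inr hω
    · exact Or.inl (h ω hω)
  have h2 : P.real Set.univ ≤ P.real good + P.real bad := by
    simp only [Measure.real]
    rw [← ENNReal.toReal_add (measure_ne_top _ _) (measure_ne_top _ _), measure_univ]
    exact ENNReal.toReal_mono (by simp [measure_ne_top]) h1
  have h3 : P.real bad ≤ c := ENNReal.toReal_le_of_le_ofReal hc hbad
  simp only [probReal_univ] at h2
  change 1 - c ≤ P.real good
  linarith

lemma eventually_mul_log_le_rpow {a : ℝ} (ha : 0 < a) (c : ℝ) (hc : 0 < c) :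
    ∀ᶠ p : ℕ in atTop, c * Real.log p ≤ (p : ℝ) ^ a := by
  have h := (isLittleO_log_rpow_atTop ha).bound (inv_pos.2 hc)
  filter_upwards [tendsto_natCast_atTop_atTop.eventually h, eventually_ge_atTop 1] with p hp hp1
  have hp1' : (1 : ℝ) ≤ p := by exact_mod_cast hp1
  rw [Real.norm_of_nonneg (Real.log_nonneg hp1'), Real.norm_of_nonneg (by positivity)] at hp
  rw [inv_mul_eq_div, le_div_iff₀ hc] at hp
  linarith

lemma eventually_le_natCast_rpow {a : ℝ} (ha : 0 < a) (c : ℝ) :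
    ∀ᶠ p : ℕ in atTop, c ≤ (p : ℝ) ^ a :=
  ((tendsto_rpow_atTop ha).comp tendsto_natCast_atTop_atTop).eventually_ge_atTop c

lemma eventually_nDim_le {θ : ℝ} (hθ0 : 0 < θ) (hθ1 : θ < 1) :
    ∀ᶠ p : ℕ in atTop, nDim p θ ≤ p := by
  filter_upwards [eventually_le_natCast_rpow (sub_pos.2 hθ1) 2, eventually_le_natCast_rpow hθ0 1,
    eventually_ge_atTop 1] with p h h1 hp
  have hp0 : (0 : ℝ) < p := by exact_mod_cast hp
  refine Nat.ceil_le.2 ?_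
  have h2 : (p : ℝ) = p ^ (1 - θ) * p ^ θ := by
    rw [← Real.rpow_add hp0, sub_add_cancel, Real.rpow_one]
  nlinarith

theorem recovery_colored {α β θ : ℝ} (hβ0 : 0 < β) (hβ1 : β < 1) (hθ0 : 0 < θ) (hθ1 : θ < 1)
    (hβl : (1 - θ) / 2 < β) (hβu : β < 1 / 2) (hmain : α < etaCluT θ β)
    {B : (p : ℕ) → Matrix (Fin p) (Fin p) ℝ}
    (hB : ∀ δ' : ℝ, 0 < δ' → ∀ᶠ p : ℕ in atTop, specNorm (B p) ≤ (p : ℝ) ^ δ')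
    {ξ : (p : ℕ) → Omega (nDim p θ) p → Fin (nDim p θ) → ℝ}
    (hξ : ∀ p : ℕ, 1 ≤ p → ∀ ω, IsTopEigenvector (gram (dataColoredB (B p) ω)) (ξ p ω)) :
    ∃ δ C : ℝ, 0 < δ ∧ 0 < C ∧ ∀ᶠ p : ℕ in atTop,
      1 - C * (p : ℝ) ^ (-(3 : ℝ)) ≤
        ((jointLaw (nDim p θ) p ((p : ℝ) ^ (-β)) ((p : ℝ) ^ (-α)))
          {ω | min (linf fun i => √(nDim p θ) * ξ p ω i + ω.1 i)
            (linf fun i => √(nDim p θ) * ξ p ω i - ω.1 i) < (p : ℝ) ^ (-δ)}).toReal := by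
  have hγ : 0 < (1 + θ) / 2 - β - 2 * α := by
    rw [etaCluT, if_neg (by linarith), if_pos hβu] at hmain
    linarith
  set δ := ((1 + θ) / 2 - β - 2 * α) / 16 with hδ_def
  have hδ : 0 < δ := by positivity
  obtain ⟨K, hK⟩ := exists_nat_ge (1 / δ)
  refine ⟨δ, 4 * K + 5, hδ, by positivity, ?_⟩
  filter_upwards [eventually_ge_atTop 100, eventually_nDim_le hθ0 hθ1,
    eventually_le_natCast_rpow hδ 16, eventually_mul_log_le_rpow hδ 30 (by norm_num),
    eventually_mul_log_le_rpow (sub_pos.2 hβ1) 30 (by norm_num), hB δ hδ]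
    with p hp100 hnp hx hxlog hylog hBp
  have hp100' : (100 : ℝ) ≤ p := by exact_mod_cast hp100
  have hp0 : (0 : ℝ) < p := by linarith
  have hp1 : (1 : ℝ) ≤ p := by linarith
  set n := nDim p θ with hn_def
  set x := (p : ℝ) ^ δ with hx_def
  have hx0 : 0 < x := by linarith
  have hnθ : (p : ℝ) ^ θ ≤ n := Nat.le_ceil _
  have hn0 : 0 < n := Nat.ceil_pos.2 (by positivity)
  have hn0' : (0 : ℝ) < n := by exact_mod_cast hn0
  have hnp' : (n : ℝ) ≤ p := by exact_mod_cast hnp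
  set m := (p : ℝ) * (p : ℝ) ^ (-β) * ((p : ℝ) ^ (-α)) ^ 2 with hm_def
  have hm_eq : m = (p : ℝ) ^ (1 - β - 2 * α) := by
    rw [hm_def, ← Real.rpow_mul_natCast hp0.le, ← Real.rpow_one_add' hp0.le (by linarith),
      ← Real.rpow_add hp0]
    push_cast; ring_nf
  have hx16 : x ^ 16 = (p : ℝ) ^ ((1 + θ) / 2 - β - 2 * α) := by
    rw [hx_def, ← Real.rpow_mul_natCast hp0.le, hδ_def]; push_cast; ring_nf
  have hm : x ^ 16 ≤ m := by
    rw [hx16, hm_eq]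
    exact Real.rpow_le_rpow_of_exponent_le hp1 (by linarith)
  have hnm : x ^ 16 * √(n * p) ≤ n * m := by
    have hsq : √(p : ℝ) ≤ p ^ ((1 - θ) / 2) * √n := by
      refine Real.sqrt_le_left (by positivity) |>.2 ?_
      rw [mul_pow, Real.sq_sqrt hn0'.le, ← Real.rpow_mul_natCast hp0.le]
      calc (p : ℝ) = p ^ ((1 - θ) / 2 * (2 : ℕ)) * p ^ θ := by
            rw [← Real.rpow_add hp0]
            push_cast
            ring_nf
            rw [Real.rpow_one]
        _ ≤ _ := by gcongr
    have hmx : m = x ^ 16 * (p : ℝ) ^ ((1 - θ) / 2) := by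
      rw [hx16, hm_eq, ← Real.rpow_add hp0]; ring_nf
    calc x ^ 16 * √(n * p) = x ^ 16 * (√n * √p) := by rw [Real.sqrt_mul hn0'.le]
      _ ≤ x ^ 16 * (√n * (p ^ ((1 - θ) / 2) * √n)) := by gcongr
      _ = √n * √n * m := by rw [hmx]; ring
      _ = _ := by rw [Real.mul_self_sqrt hn0'.le]
  obtain ⟨hs, hD, hw⟩ := signal_dominates_noise hp0 hn0' hnp' hx hm hnm
  have hx4 : (16 : ℝ) ^ 4 ≤ x ^ 4 := by gcongr
  have hx4' : 0 < x ^ 4 := by positivity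
  have hKle : √n * (2 * (x ^ 4)⁻¹) ^ K ≤ 1 := by
    have h1 : 2 * (x ^ 4)⁻¹ ≤ x⁻¹ := by
      rw [mul_inv_le_iff₀ hx4']
      have : x⁻¹ * x ^ 4 = x ^ 3 := by field_simp
      rw [this]
      have : (16 : ℝ) ^ 3 ≤ x ^ 3 := by gcongr
      linarith
    have h2 : (p : ℝ) ≤ x ^ K := by
      rw [hx_def, ← Real.rpow_mul_natCast hp0.le]
      conv_lhs => rw [← Real.rpow_one (p : ℝ)]
      refine Real.rpow_le_rpow_of_exponent_le hp1 ?_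
      rw [div_le_iff₀ hδ] at hK
      linarith
    have h3 : √(n : ℝ) ≤ p := by
      rw [Real.sqrt_le_left hp0.le]; nlinarith
    calc √n * (2 * (x ^ 4)⁻¹) ^ K ≤ x ^ K * x⁻¹ ^ K := by
          gcongr
          exact h3.trans h2
      _ = 1 := by rw [← mul_pow, mul_inv_cancel₀ hx0.ne', one_pow]
  have hBl : ∀ v, l2 (B p *ᵥ v) ≤ x * l2 v := fun v =>
    (l2_mulVec_le_specNorm _ v).trans (mul_le_mul_of_nonneg_right hBp (l2_nonneg v))
  have hε1 : (p : ℝ) ^ (-β) ≤ 1 := Real.rpow_le_one_of_one_le_of_nonpos hp1 (by linarith)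
  have hε0 : (0 : ℝ) < (p : ℝ) ^ (-β) := by positivity
  have hbad := jointLaw_not_recovery_le (τ := (p : ℝ) ^ (-α)) hn0 hnp hε0 hε1 (by positivity)
    hx0.le hx0 hx0 (κ := (x ^ 4)⁻¹) (by positivity)
    ((inv_le_comm₀ hx4' (by norm_num)).2 (by linarith)) hBl
    (fun v => l2_transpose_mulVec_le_of_l2_mulVec_le hx0.le hBl v) hs hD hw hKle
    (hξ p (by omega))
  have hprob := isProbabilityMeasure_jointLaw (n := n) (p := p) (τ := (p : ℝ) ^ (-α)) hε0.le hε1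
  have hpε : (p : ℝ) * (p : ℝ) ^ (-β) = (p : ℝ) ^ (1 - β) := by
    rw [← Real.rpow_one_add' hp0.le (by linarith)]; ring_nf
  refine one_sub_le_toReal_of_not_le _ (fun ω hω => ?_) (by positivity)
    (hbad.trans (ENNReal.ofReal_le_ofReal ?_))
  · have hlt : 100 * (x ^ 4)⁻¹ < (p : ℝ) ^ (-δ) := by
      rw [Real.rpow_neg hp0.le, mul_inv_lt_iff₀ hx4']
      have : x⁻¹ * x ^ 4 = x ^ 3 := by field_simp
      rw [this]
      have : (16 : ℝ) ^ 3 ≤ x ^ 3 := by gcongr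
      linarith
    have hω := not_not.1 hω
    rcases hω with h | h
    · exact (min_le_right _ _).trans_lt ((linf_le hn0 h).trans_lt hlt)
    · exact (min_le_left _ _).trans_lt ((linf_le hn0 h).trans_lt hlt)
  · rw [hpε]
    exact failure_bound_le K hp100' hn0 hnp' (by linarith) hxlog hylog

lemma dataColoredB_one {n p : ℕ} (ω : Omega n p) :
    dataColoredB (1 : Matrix (Fin p) (Fin p) ℝ) ω = dataMap ω := by
  ext i j
  simp [dataColoredB, dataMap]

lemma specNorm_one_le (p : ℕ) : specNorm (1 : Matrix (Fin p) (Fin p) ℝ) ≤ 1 := by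
  refine csSup_le ⟨_, 0, by simp [l2], rfl⟩ ?_
  rintro _ ⟨v, hv, rfl⟩
  simpa using hv

end Asymptotics

end ARWPaper

open ARWPaper Filter in
/-- classical PCA recovers the labels. If `(1-θ)/2 < β < 1/2` and
`α < η̃^clu_θ(β)`, then for any unit top eigenvector `ξ` of `XX'`, with probability
`1 - O(p^{-3})` one has `min{‖√n ξ + ℓ‖_∞, ‖√n ξ - ℓ‖_∞} < p^{-δ}`; the same holds
with `Z` replaced by `Z B_p` for nonrandom invertible `B_p` with multi-log norms. -/
theorem classical_pca_recovery
    (α β θ : ℝ) (hα0 : 0 < α) (hα1 : α < 1) (hβ0 : 0 < β) (hβ1 : β < 1)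
    (hθ0 : 0 < θ) (hθ1 : θ < 1)
    (hβl : (1 - θ) / 2 < β) (hβu : β < 1 / 2) (hmain : α < etaCluT θ β) :
    (∀ ξsel : (p : ℕ) → (Fin (nDim p θ) → Fin p → ℝ) → Fin (nDim p θ) → ℝ,
      (∀ p : ℕ, 1 ≤ p → ∀ X, IsTopEigenvector (gram X) (ξsel p X)) →
      ∃ δ C : ℝ, 0 < δ ∧ 0 < C ∧
        ∀ᶠ p : ℕ in atTop,
          1 - C * (p : ℝ) ^ (-(3 : ℝ)) ≤
            ((jointLaw (nDim p θ) p ((p : ℝ) ^ (-β)) ((p : ℝ) ^ (-α)))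
              {ω | min
                  (linf fun i => Real.sqrt (nDim p θ) * ξsel p (dataMap ω) i + ω.1 i)
                  (linf fun i => Real.sqrt (nDim p θ) * ξsel p (dataMap ω) i - ω.1 i) <
                (p : ℝ) ^ (-δ)}).toReal) ∧
    (∀ B : (p : ℕ) → Matrix (Fin p) (Fin p) ℝ,
      (∀ p, IsUnit (B p)) →
      (∀ δ' : ℝ, 0 < δ' →
        Tendsto
          (fun p : ℕ => (p : ℝ) ^ (-δ') * max (specNorm (B p)) (specNorm (B p)⁻¹))
          atTop (nhds 0)) →
      ∀ ξsel : (p : ℕ) → (Fin (nDim p θ) → Fin p → ℝ) → Fin (nDim p θ) → ℝ,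
        (∀ p : ℕ, 1 ≤ p → ∀ X, IsTopEigenvector (gram X) (ξsel p X)) →
        ∃ δ C : ℝ, 0 < δ ∧ 0 < C ∧
          ∀ᶠ p : ℕ in atTop,
            1 - C * (p : ℝ) ^ (-(3 : ℝ)) ≤
              ((jointLaw (nDim p θ) p ((p : ℝ) ^ (-β)) ((p : ℝ) ^ (-α)))
                {ω | min
                    (linf fun i =>
                      Real.sqrt (nDim p θ) * ξsel p (dataColoredB (B p) ω) i + ω.1 i)
                    (linf fun i =>
                      Real.sqrt (nDim p θ) * ξsel p (dataColoredB (B p) ω) i - ω.1 i) <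
                  (p : ℝ) ^ (-δ)}).toReal) := by
  refine ⟨fun ξsel hξ => ?_, fun B _ hB ξsel hξ => ?_⟩
  · refine recovery_colored hβ0 hβ1 hθ0 hθ1 hβl hβu hmain (B := fun p => 1) (fun δ' hδ' => ?_)
      (ξ := fun p ω => ξsel p (dataMap ω)) fun p hp ω => ?_
    · filter_upwards [eventually_le_natCast_rpow hδ' 1] with p hp
      exact (specNorm_one_le p).trans hp
    · rw [dataColoredB_one]
      exact hξ p hp _
  · refine recovery_colored hβ0 hβ1 hθ0 hθ1 hβl hβu hmain (B := B) (fun δ' hδ' => ?_)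
      (ξ := fun p ω => ξsel p (dataColoredB (B p) ω)) fun p hp ω => hξ p hp _
    filter_upwards [(hB δ' hδ').eventually_le_const zero_lt_one, eventually_ge_atTop 1]
      with p h hp
    have hp0 : (0 : ℝ) < p := by exact_mod_cast hp
    rw [Real.rpow_neg hp0.le, inv_mul_le_one₀ (by positivity)] at h
    exact (le_max_left _ _).trans h
end

section
/- For every ε > 0 there exists N ∈ ℕ such that for all n ≥ N, all h > 0, and all x with 0 ≤ x ≤ √n/log n: if z_1,…,z_n are i.i.d. standard normal random variables, then P( |Σ_{i=1}^n (|z_i + h| − E|z_i + h|)| ≥ √n·x ) ≤ 2·exp(−(1−ε)·x²/2). -/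
open MeasureTheory ProbabilityTheory Filter
open scoped ENNReal NNReal Classical BigOperators

lemma Real.exp_mul_le_quadratic_add_cubic {u y : ℝ} (hu : |u| ≤ 1) :
    Real.exp (u * y) ≤ 1 + u * y + u ^ 2 / 2 * y ^ 2 + |u| ^ 3 * (6 * Real.exp (2 * |y|)) := by
  have h1 := Complex.norm_exp_sub_sum_le_norm_mul_exp ((u * y : ℝ) : ℂ) 3
  have h2 : Complex.exp ((u * y : ℝ) : ℂ) -
      ∑ m ∈ Finset.range 3, ((u * y : ℝ) : ℂ) ^ m / (m.factorial : ℂ) =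
      ((Real.exp (u * y) - (1 + u * y + u ^ 2 / 2 * y ^ 2) : ℝ) : ℂ) := by
    simp only [Finset.sum_range_succ, Finset.sum_range_zero, Nat.factorial]
    push_cast
    ring
  rw [h2, Complex.norm_real, Complex.norm_real, Real.norm_eq_abs, Real.norm_eq_abs, abs_mul,
    mul_pow] at h1
  have h3 : |y| ^ 3 ≤ 6 * Real.exp |y| := by
    have := Real.pow_div_factorial_le_exp |y| (abs_nonneg y) 3
    norm_num [Nat.factorial] at this
    linarith
  have h4 : Real.exp (|u| * |y|) ≤ Real.exp |y| :=
    Real.exp_le_exp.mpr (mul_le_of_le_one_left (abs_nonneg y) hu)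
  have h5 : |y| ^ 3 * Real.exp (|u| * |y|) ≤ 6 * Real.exp (2 * |y|) := by
    calc |y| ^ 3 * Real.exp (|u| * |y|) ≤ (6 * Real.exp |y|) * Real.exp |y| := by gcongr
      _ = 6 * Real.exp (2 * |y|) := by rw [mul_assoc, ← Real.exp_add, two_mul]
  have h6 := mul_le_mul_of_nonneg_left h5 (pow_nonneg (abs_nonneg u) 3)
  have h7 := le_abs_self (Real.exp (u * y) - (1 + u * y + u ^ 2 / 2 * y ^ 2))
  linarith

lemma integral_exp_mul_le_exp_of_centered {Ω : Type*} [MeasurableSpace Ω] {μ : Measure Ω}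
    [IsProbabilityMeasure μ] {Y : Ω → ℝ} {K u ε : ℝ} (hY : Integrable Y μ)
    (hY2 : Integrable (fun ω => Y ω ^ 2) μ)
    (hexp : Integrable (fun ω => Real.exp (2 * |Y ω|)) μ) (hmean : ∫ ω, Y ω ∂μ = 0)
    (hvar : ∫ ω, Y ω ^ 2 ∂μ ≤ 1) (hK : 6 * ∫ ω, Real.exp (2 * |Y ω|) ∂μ ≤ K)
    (hu : |u| ≤ 1) (huK : |u| * K ≤ ε / 2) :
    ∫ ω, Real.exp (u * Y ω) ∂μ ≤ Real.exp ((1 + ε) * u ^ 2 / 2) := by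
  have i1 : Integrable (fun ω => 1 + u * Y ω) μ := (integrable_const 1).add (hY.const_mul u)
  have i2 : Integrable (fun ω => 1 + u * Y ω + u ^ 2 / 2 * Y ω ^ 2) μ :=
    i1.add (hY2.const_mul (u ^ 2 / 2))
  have i3 : Integrable (fun ω => |u| ^ 3 * (6 * Real.exp (2 * |Y ω|))) μ :=
    (hexp.const_mul 6).const_mul _
  calc ∫ ω, Real.exp (u * Y ω) ∂μ
      ≤ ∫ ω, (1 + u * Y ω + u ^ 2 / 2 * Y ω ^ 2 + |u| ^ 3 * (6 * Real.exp (2 * |Y ω|))) ∂μ :=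
        integral_mono_of_nonneg (ae_of_all _ fun ω => (Real.exp_pos _).le) (i2.add i3)
          (ae_of_all _ fun ω => Real.exp_mul_le_quadratic_add_cubic hu)
    _ = 1 + u ^ 2 / 2 * ∫ ω, Y ω ^ 2 ∂μ +
          |u| ^ 3 * (6 * ∫ ω, Real.exp (2 * |Y ω|) ∂μ) := by
        rw [integral_add i2 i3, integral_add i1 (hY2.const_mul _),
          integral_add (integrable_const 1) (hY.const_mul u)]
        simp only [integral_const_mul, hmean]
        simp
    _ ≤ 1 + u ^ 2 / 2 * 1 + |u| ^ 3 * K := by gcongr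
    _ = 1 + u ^ 2 / 2 * 1 + u ^ 2 * (|u| * K) := by rw [← sq_abs u]; ring
    _ ≤ 1 + u ^ 2 / 2 * 1 + u ^ 2 * (ε / 2) := by gcongr
    _ = (1 + ε) * u ^ 2 / 2 + 1 := by ring
    _ ≤ Real.exp ((1 + ε) * u ^ 2 / 2) := Real.add_one_le_exp _

lemma measureReal_pi_le_abs_sum_le {Ω : Type*} [MeasurableSpace Ω] {μ : Measure Ω}
    [IsProbabilityMeasure μ] {Y : Ω → ℝ} {n : ℕ} (hn : 0 < n) {x ε : ℝ} (hx : 0 ≤ x)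
    (hint : ∀ u : ℝ, Integrable (fun ω => Real.exp (u * Y ω)) μ)
    (hmgf : ∀ u : ℝ, |u| = x / √n →
      ∫ ω, Real.exp (u * Y ω) ∂μ ≤ Real.exp ((1 + ε) * u ^ 2 / 2)) :
    (Measure.pi fun _ : Fin n => μ).real {z | √n * x ≤ |∑ i, Y (z i)|} ≤
      2 * Real.exp (-(1 - ε) * x ^ 2 / 2) := by
  have hs : 0 < √(n : ℝ) := Real.sqrt_pos.mpr (by exact_mod_cast hn)
  have hsn : √(n : ℝ) ^ 2 = n := Real.sq_sqrt (Nat.cast_nonneg n)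
  have hprod (u : ℝ) : (fun z : Fin n → Ω => Real.exp (u * ∑ i, Y (z i))) =
      fun z => ∏ i, Real.exp (u * Y (z i)) := by
    ext z
    rw [Finset.mul_sum, Real.exp_sum]
  have hpi (u : ℝ) : Integrable (fun z : Fin n → Ω => Real.exp (u * ∑ i, Y (z i)))
      (Measure.pi fun _ => μ) := by
    rw [hprod]
    exact Integrable.fintype_prod fun _ => hint u
  have hmgf_pi (u : ℝ) (hu : |u| = x / √n) :
      mgf (fun z : Fin n → Ω => ∑ i, Y (z i)) (Measure.pi fun _ => μ) u ≤
        Real.exp ((1 + ε) * x ^ 2 / 2) := by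
    have hu2 : n * u ^ 2 = x ^ 2 := by
      rw [← sq_abs u, hu, div_pow, hsn]
      field_simp
    rw [mgf, hprod,
      integral_fintype_prod_eq_prod (μ := fun _ => μ) (fun _ ω => Real.exp (u * Y ω)),
      Finset.prod_const, Finset.card_univ, Fintype.card_fin]
    calc (∫ ω, Real.exp (u * Y ω) ∂μ) ^ n ≤ Real.exp ((1 + ε) * u ^ 2 / 2) ^ n :=
          pow_le_pow_left₀ (integral_nonneg fun ω => (Real.exp_pos _).le) (hmgf u hu) n
      _ = Real.exp ((1 + ε) * x ^ 2 / 2) := by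
          rw [← Real.exp_nat_mul, ← hu2]
          ring_nf
  have hfinal {a b : ℝ} (ha : a = -x ^ 2) (hb : b ≤ Real.exp ((1 + ε) * x ^ 2 / 2)) :
      Real.exp a * b ≤ Real.exp (-(1 - ε) * x ^ 2 / 2) := by
    calc Real.exp a * b ≤ Real.exp a * Real.exp ((1 + ε) * x ^ 2 / 2) := by gcongr
      _ = Real.exp (-(1 - ε) * x ^ 2 / 2) := by
          rw [← Real.exp_add, ha]
          ring_nf
  have hu0 : 0 ≤ x / √(n : ℝ) := by positivity
  have hupper := (measure_ge_le_exp_mul_mgf (√(n : ℝ) * x) hu0 (hpi _)).trans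
    (hfinal (by field_simp) (hmgf_pi _ (abs_of_nonneg hu0)))
  have hlower := (measure_le_le_exp_mul_mgf (-(√(n : ℝ) * x)) (neg_nonpos.mpr hu0) (hpi _)).trans
    (hfinal (by field_simp) (hmgf_pi _ (by rw [abs_neg, abs_of_nonneg hu0])))
  have hsub : {z : Fin n → Ω | √n * x ≤ |∑ i, Y (z i)|} ⊆
      {z | √n * x ≤ ∑ i, Y (z i)} ∪ {z | ∑ i, Y (z i) ≤ -(√n * x)} := by
    intro z (hz : √n * x ≤ |∑ i, Y (z i)|)
    rcases le_abs.mp hz with h | h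
    · exact Or.inl h
    · exact Or.inr (le_neg.mpr h)
  calc _ ≤ _ := measureReal_mono hsub
    _ ≤ _ := measureReal_union_le _ _
    _ ≤ _ := add_le_add hupper hlower
    _ = _ := (two_mul _).symm

lemma integrable_exp_mul_abs_gaussianReal (t : ℝ) :
    Integrable (fun x => Real.exp (t * |x|)) (gaussianReal 0 1) := by
  refine Integrable.mono' ((integrable_exp_mul_gaussianReal t).add
    (integrable_exp_mul_gaussianReal (-t))) (by fun_prop) (ae_of_all _ fun x => ?_)
  rw [Real.norm_eq_abs, Real.abs_exp, Pi.add_apply]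
  rcases abs_cases x with ⟨h, -⟩ | ⟨h, -⟩ <;> rw [h]
  · exact le_add_of_nonneg_right (Real.exp_pos _).le
  · rw [mul_neg, ← neg_mul]
    exact le_add_of_nonneg_left (Real.exp_pos _).le

lemma integrable_id_gaussianReal_zero_one : Integrable (fun t : ℝ => t) (gaussianReal 0 1) :=
  (memLp_id_gaussianReal (μ := 0) (v := 1) 1).integrable (by simp)

lemma integrable_sq_gaussianReal_zero_one :
    Integrable (fun t : ℝ => t ^ 2) (gaussianReal 0 1) :=
  (memLp_id_gaussianReal (μ := 0) (v := 1) 2).integrable_sq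

lemma integral_sq_gaussianReal_zero_one : ∫ t, t ^ 2 ∂(gaussianReal 0 1) = 1 := by
  have h := variance_eq_sub (memLp_id_gaussianReal (μ := 0) (v := 1) 2)
  rw [variance_id_gaussianReal] at h
  simpa using h.symm

section FoldedNormal

variable (h : ℝ)

lemma integrable_abs_add_gaussianReal : Integrable (fun t => |t + h|) (gaussianReal 0 1) :=
  (integrable_id_gaussianReal_zero_one.add (integrable_const h)).abs

lemma integral_add_gaussianReal : ∫ t, (t + h) ∂(gaussianReal 0 1) = h := by
  rw [integral_add integrable_id_gaussianReal_zero_one (integrable_const h)]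
  simp

lemma le_integral_abs_add_gaussianReal : |h| ≤ ∫ t, |t + h| ∂(gaussianReal 0 1) := by
  simpa only [integral_add_gaussianReal] using
    abs_integral_le_integral_abs (f := fun t => t + h) (μ := gaussianReal 0 1)

lemma integral_abs_add_gaussianReal_le :
    ∫ t, |t + h| ∂(gaussianReal 0 1) ≤ ∫ t, |t| ∂(gaussianReal 0 1) + |h| := by
  have habs := integrable_id_gaussianReal_zero_one.abs
  calc ∫ t, |t + h| ∂(gaussianReal 0 1) ≤ ∫ t, (|t| + |h|) ∂(gaussianReal 0 1) :=
        integral_mono (integrable_abs_add_gaussianReal h) (habs.add (integrable_const _))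
          fun t => abs_add_le t h
    _ = _ := by
        rw [integral_add habs (integrable_const _)]
        simp

lemma abs_centered_abs_add_gaussianReal_le (t : ℝ) :
    |(|t + h| - ∫ s, |s + h| ∂(gaussianReal 0 1))| ≤ |t| + ∫ s, |s| ∂(gaussianReal 0 1) := by
  have h1 := le_integral_abs_add_gaussianReal h
  have h2 := integral_abs_add_gaussianReal_le h
  have h3 := abs_add_le t h
  have h4 : |h| ≤ |t + h| + |t| := by simpa using abs_sub (t + h) t
  exact abs_le.mpr ⟨by linarith, by linarith⟩

lemma integrable_centered_abs_add_gaussianReal :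
    Integrable (fun t => |t + h| - ∫ s, |s + h| ∂(gaussianReal 0 1)) (gaussianReal 0 1) :=
  (integrable_abs_add_gaussianReal h).sub (integrable_const _)

lemma integral_centered_abs_add_gaussianReal :
    ∫ t, (|t + h| - ∫ s, |s + h| ∂(gaussianReal 0 1)) ∂(gaussianReal 0 1) = 0 := by
  rw [integral_sub (integrable_abs_add_gaussianReal h) (integrable_const _)]
  simp

lemma memLp_two_centered_abs_add_gaussianReal :
    MemLp (fun t => |t + h| - ∫ s, |s + h| ∂(gaussianReal 0 1)) 2 (gaussianReal 0 1) :=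
  (((memLp_id_gaussianReal 2).add (memLp_const h)).abs).sub (memLp_const _)

lemma integral_sq_centered_abs_add_gaussianReal_le :
    ∫ t, (|t + h| - ∫ s, |s + h| ∂(gaussianReal 0 1)) ^ 2 ∂(gaussianReal 0 1) ≤ 1 := by
  set m := ∫ s, |s + h| ∂(gaussianReal 0 1) with hm
  have hid := integrable_id_gaussianReal_zero_one
  have i1 : Integrable (fun t => t ^ 2 + 2 * h * t) (gaussianReal 0 1) :=
    integrable_sq_gaussianReal_zero_one.add (hid.const_mul _)
  have i2 : Integrable (fun t => t ^ 2 + 2 * h * t - 2 * m * |t + h|) (gaussianReal 0 1) :=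
    i1.sub ((integrable_abs_add_gaussianReal h).const_mul _)
  have heq : ∫ t, (|t + h| - m) ^ 2 ∂(gaussianReal 0 1) = 1 + h ^ 2 - m ^ 2 := by
    calc ∫ t, (|t + h| - m) ^ 2 ∂(gaussianReal 0 1)
        = ∫ t, (t ^ 2 + 2 * h * t - 2 * m * |t + h| + (h ^ 2 + m ^ 2)) ∂(gaussianReal 0 1) := by
          refine integral_congr_ae (ae_of_all _ fun t => ?_)
          simp only [sub_sq, sq_abs]
          ring
      _ = 1 + h ^ 2 - m ^ 2 := by
          rw [integral_add i2 (integrable_const _),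
            integral_sub i1 ((integrable_abs_add_gaussianReal h).const_mul _),
            integral_add integrable_sq_gaussianReal_zero_one (hid.const_mul _),
            integral_const_mul, integral_const_mul, ← hm, integral_sq_gaussianReal_zero_one,
            integral_id_gaussianReal]
          simp
          ring
  have hle : h ^ 2 ≤ m ^ 2 := by
    rw [← sq_abs h]
    exact pow_le_pow_left₀ (abs_nonneg h) (le_integral_abs_add_gaussianReal h) 2
  linarith

lemma integrable_exp_mul_centered_abs_add_gaussianReal (u : ℝ) :
    Integrable (fun t => Real.exp (u * (|t + h| - ∫ s, |s + h| ∂(gaussianReal 0 1))))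
      (gaussianReal 0 1) := by
  refine Integrable.mono' ((integrable_exp_mul_abs_gaussianReal |u|).const_mul
    (Real.exp (|u| * ∫ s, |s| ∂(gaussianReal 0 1)))) (by fun_prop) (ae_of_all _ fun t => ?_)
  rw [Real.norm_eq_abs, Real.abs_exp, ← Real.exp_add, Real.exp_le_exp, ← mul_add,
    add_comm (∫ s, |s| ∂(gaussianReal 0 1))]
  refine (le_abs_self _).trans ?_
  rw [abs_mul]
  exact mul_le_mul_of_nonneg_left (abs_centered_abs_add_gaussianReal_le h t) (abs_nonneg u)

lemma integrable_exp_two_mul_abs_add_const_gaussianReal (c : ℝ) :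
    Integrable (fun t => Real.exp (2 * (|t| + c))) (gaussianReal 0 1) := by
  simpa only [mul_add, Real.exp_add] using
    (integrable_exp_mul_abs_gaussianReal 2).mul_const (Real.exp (2 * c))

lemma exp_two_mul_abs_centered_abs_add_gaussianReal_le (t : ℝ) :
    Real.exp (2 * |(|t + h| - ∫ s, |s + h| ∂(gaussianReal 0 1))|) ≤
      Real.exp (2 * (|t| + ∫ s, |s| ∂(gaussianReal 0 1))) := by
  gcongr
  exact abs_centered_abs_add_gaussianReal_le h t

lemma integrable_exp_two_mul_abs_centered_abs_add_gaussianReal :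
    Integrable (fun t => Real.exp (2 * |(|t + h| - ∫ s, |s + h| ∂(gaussianReal 0 1))|))
      (gaussianReal 0 1) := by
  refine (integrable_exp_two_mul_abs_add_const_gaussianReal
    (∫ s, |s| ∂(gaussianReal 0 1))).mono' (by fun_prop)
    (ae_of_all _ fun t => ?_)
  rw [Real.norm_eq_abs, Real.abs_exp]
  exact exp_two_mul_abs_centered_abs_add_gaussianReal_le h t

end FoldedNormal

open ARWPaper Filter MeasureTheory ProbabilityTheory in
/-- uniform large-deviation inequality for sums of centered folded
normal random variables: for every `ε > 0` and all large `n`, uniformly in `h > 0`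
and `0 ≤ x ≤ √n / log n`,
`P(|Σ_{i=1}^n (|z_i + h| - E|z_i + h|)| ≥ √n x) ≤ 2 exp(-(1-ε) x²/2)`. -/
theorem folded_normal_large_deviation :
    ∀ ε : ℝ, 0 < ε → ∃ N : ℕ, ∀ n : ℕ, N ≤ n → ∀ h : ℝ, 0 < h → ∀ x : ℝ,
      0 ≤ x → x ≤ Real.sqrt n / Real.log n →
      ((gaussPi n)
        {z | Real.sqrt n * x ≤
          |∑ i, (|z i + h| - ∫ t, |t + h| ∂(gaussianReal 0 1))|}).toReal ≤
        2 * Real.exp (-(1 - ε) * x ^ 2 / 2) := by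
  intro ε hε
  let K : ℝ := 6 * ∫ t, Real.exp (2 * (|t| + ∫ s, |s| ∂(gaussianReal 0 1))) ∂(gaussianReal 0 1)
  have hlog : Tendsto (fun n : ℕ => Real.log n) atTop atTop :=
    Real.tendsto_log_atTop.comp tendsto_natCast_atTop_atTop
  obtain ⟨N, hN⟩ := eventually_atTop.mp
    ((hlog.eventually_ge_atTop (max 1 (2 * K / ε))).and (eventually_gt_atTop 0))
  refine ⟨N, fun n hn h _ x hx hxn => ?_⟩
  obtain ⟨hlogn, hn0⟩ := hN n hn
  obtain ⟨hlog1, hlogK⟩ := max_le_iff.mp hlogn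
  have hlog0 : 0 < Real.log n := one_pos.trans_le hlog1
  have hK0 : 0 ≤ K := by positivity
  have hs : 0 < √(n : ℝ) := Real.sqrt_pos.mpr (by exact_mod_cast hn0)
  refine measureReal_pi_le_abs_sum_le
    (Y := fun t => |t + h| - ∫ s, |s + h| ∂(gaussianReal 0 1)) hn0 hx
    (integrable_exp_mul_centered_abs_add_gaussianReal h) fun u hu => ?_
  have hul : |u| ≤ 1 / Real.log n := by
    rw [hu, div_le_iff₀ hs, one_div_mul_eq_div]
    exact hxn
  refine integral_exp_mul_le_exp_of_centered (K := K)
    (Y := fun t => |t + h| - ∫ s, |s + h| ∂(gaussianReal 0 1))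
    (integrable_centered_abs_add_gaussianReal h)
    (memLp_two_centered_abs_add_gaussianReal h).integrable_sq
    (integrable_exp_two_mul_abs_centered_abs_add_gaussianReal h)
    (integral_centered_abs_add_gaussianReal h)
    (integral_sq_centered_abs_add_gaussianReal_le h) ?_ ?_ ?_
  · exact mul_le_mul_of_nonneg_left
      (integral_mono (integrable_exp_two_mul_abs_centered_abs_add_gaussianReal h)
        (integrable_exp_two_mul_abs_add_const_gaussianReal _)
        (exp_two_mul_abs_centered_abs_add_gaussianReal_le h)) (by norm_num)
  · exact hul.trans ((div_le_one hlog0).mpr hlog1)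
  · calc |u| * K ≤ 1 / Real.log n * K := by gcongr
      _ ≤ ε / 2 := by
        rw [div_le_iff₀ hε] at hlogK
        rw [one_div_mul_eq_div, div_le_iff₀ hlog0]
        linarith
end

section
/- Define u(h) = E|W + h| for W a standard normal random variable. Then there exists a constant C > 0 such that for all 0 < h_1 < h_2, u(h_2) − u(h_1) ≥ C·min{h_2 − h_1, (h_2 − h_1)²}. -/
open MeasureTheory ProbabilityTheory Filter
open scoped ENNReal NNReal Classical BigOperators

open MeasureTheory ProbabilityTheory in
lemma integrable_abs_add_const_gaussianReal (m : ℝ) (v : NNReal) (h : ℝ) :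
    Integrable (fun t : ℝ => |t + h|) (gaussianReal m v) :=
  (((memLp_id_gaussianReal (μ := m) (v := v) 1).integrable (by simp)).add
    (integrable_const h)).abs

open MeasureTheory ProbabilityTheory in
lemma integral_abs_sub_const_gaussianReal_zero (v : NNReal) (h : ℝ) :
    ∫ t, |t - h| ∂(gaussianReal 0 v) = ∫ t, |t + h| ∂(gaussianReal 0 v) := by
  have hmap := gaussianReal_map_neg (μ := 0) (v := v)
  rw [neg_zero] at hmap
  conv_lhs => rw [← hmap]
  rw [integral_map (by fun_prop) (by fun_prop)]
  refine integral_congr_ae (.of_forall fun t => ?_)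
  simp only
  rw [← abs_neg]
  ring_nf

open MeasureTheory ProbabilityTheory in
lemma mul_gaussianPDFReal_le_measureReal_Icc {m : ℝ} (hm0 : 0 ≤ m) (hm1 : m ≤ 1) :
    m * gaussianPDFReal 0 1 1 ≤ (gaussianReal 0 1).real (Set.Icc (-(m / 2)) (m / 2)) := by
  rw [measureReal_def, gaussianReal_apply_eq_integral 0 one_ne_zero, ENNReal.toReal_ofReal
    (integral_nonneg fun x => gaussianPDFReal_nonneg 0 1 x)]
  have hle : ∀ x ∈ Set.Icc (-(m / 2)) (m / 2),
      gaussianPDFReal 0 1 1 ≤ gaussianPDFReal 0 1 x := by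
    intro x hx
    have hx2 : x ^ 2 ≤ 1 ^ 2 := by nlinarith [hx.1, hx.2]
    simp only [gaussianPDFReal_def, sub_zero]
    gcongr
  have := setIntegral_ge_of_const_le_real (μ := volume) measurableSet_Icc (by simp) hle
    (integrable_gaussianPDFReal 0 1).integrableOn
  rw [Real.volume_real_Icc_of_le (by linarith)] at this
  linarith

lemma indicator_le_abs_add_abs_sub {a b : ℝ} (ha : 0 < a) (hab : a < b) (t : ℝ) :
    (Set.Icc (-((b - a) / 2)) ((b - a) / 2)).indicator (fun _ => b - a) t ≤
      (|t + b| + |t - b|) - (|t + a| + |t - a|) := by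
  by_cases ht : t ∈ Set.Icc (-((b - a) / 2)) ((b - a) / 2)
  · rw [Set.indicator_of_mem ht]
    obtain ⟨h1, h2⟩ := ht
    rcases abs_cases (t + b) with hp | hp <;> rcases abs_cases (t - b) with hq | hq <;>
    rcases abs_cases (t + a) with hr | hr <;> rcases abs_cases (t - a) with hs | hs <;>
    linarith
  · rw [Set.indicator_of_notMem ht]
    rcases abs_cases (t + b) with hp | hp <;> rcases abs_cases (t - b) with hq | hq <;>
    rcases abs_cases (t + a) with hr | hr <;> rcases abs_cases (t - a) with hs | hs <;>
    linarith

open ARWPaper Filter MeasureTheory ProbabilityTheory in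
/-- for the folded normal mean `u(h) = E|W + h|`, `W ~ N(0,1)`, there
is a constant `C > 0` with `u(h₂) - u(h₁) ≥ C min{h₂ - h₁, (h₂ - h₁)²}` for all
`0 < h₁ < h₂`. -/
theorem folded_normal_mean_gap :
    ∃ C : ℝ, 0 < C ∧ ∀ h1 h2 : ℝ, 0 < h1 → h1 < h2 →
      C * min (h2 - h1) ((h2 - h1) ^ 2) ≤
        (∫ t, |t + h2| ∂(gaussianReal 0 1)) - ∫ t, |t + h1| ∂(gaussianReal 0 1) := by
  refine ⟨gaussianPDFReal 0 1 1 / 2,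
    half_pos (gaussianPDFReal_pos 0 1 1 one_ne_zero), fun h1 h2 h1_pos h12 => ?_⟩
  have hd : 0 < h2 - h1 := sub_pos.mpr h12
  have hmin : min (h2 - h1) ((h2 - h1) ^ 2) = (h2 - h1) * min (h2 - h1) 1 := by
    rw [mul_min_of_nonneg _ _ hd.le, mul_one, min_comm, sq]
  have hint := integrable_abs_add_const_gaussianReal 0 1
  have hint' : ∀ h : ℝ, Integrable (fun t : ℝ => |t - h|) (gaussianReal 0 1) := fun h => by
    simpa only [sub_eq_add_neg] using hint (-h)
  have hmono := integral_mono (μ := gaussianReal 0 1)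
    ((integrable_const (h2 - h1)).indicator measurableSet_Icc)
    (((hint h2).add (hint' h2)).sub ((hint h1).add (hint' h1)))
    (indicator_le_abs_add_abs_sub h1_pos h12)
  rw [integral_indicator_const _ measurableSet_Icc, smul_eq_mul,
    integral_sub' ((hint h2).add (hint' h2)) ((hint h1).add (hint' h1)),
    integral_add' (hint h2) (hint' h2), integral_add' (hint h1) (hint' h1),
    integral_abs_sub_const_gaussianReal_zero, integral_abs_sub_const_gaussianReal_zero] at hmono
  have hprob : min (h2 - h1) 1 * gaussianPDFReal 0 1 1 ≤
      (gaussianReal 0 1).real (Set.Icc (-((h2 - h1) / 2)) ((h2 - h1) / 2)) := by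
    refine (mul_gaussianPDFReal_le_measureReal_Icc (le_min hd.le zero_le_one)
      (min_le_right _ _)).trans (measureReal_mono (Set.Icc_subset_Icc ?_ ?_)) <;>
    linarith [min_le_left (h2 - h1) 1]
  rw [hmin]
  linarith [mul_le_mul_of_nonneg_right hprob hd.le]
end
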